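/- arXiv:1808.08421 — 2 statements merged into one kernel-verified Lean document; each statement's English description precedes it below -/
import Mathlib

section
/- Suppose (f_i)_{i∈I} satisfies the open set condition. Let k ∈ ℕ, ω ∈ I^k and x, y ∈ f_ω^{-1}(Ō). Then U(x,y) = A₀(ω̄,k)·U(f_ω(x), f_ω(y)), where ω̄ ∈ Σ is the periodic sequence (ω_1,…,ω_k,ω_1,…,ω_k,…). -/
open MeasureTheory Filter Topology Set

noncomputable section

/-- The symbol space `Σ = I^ℕ` with `I = {1, …, s+1}` (coded as `Fin (s+1)`). -/
abbrev Word (s : ℕ) := ℕ → Fin (s + 1)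

/-- Multi-indices `ℕ₀^s`. -/
abbrev MI (s : ℕ) := Fin s → ℕ

/-- Extension of a self-map of `ℝ` to the two-point compactification `ℝ̄ = EReal`,
fixing `±∞`. -/
def extE (f : ℝ → ℝ) (x : EReal) : EReal :=
  if x = ⊥ then ⊥ else if x = ⊤ then ⊤ else ((f x.toReal : ℝ) : EReal)

/-- The shift map `σ` on the symbol space. -/
def shiftW {s : ℕ} (ω : Word s) : Word s := fun n => ω (n + 1)

/-- `μ` is the `(p 0, …, p s)`-Bernoulli measure on the symbol space. -/
def IsBernoulli {s : ℕ} (p : Fin (s + 1) → ℝ) (μ : Measure (Word s)) : Prop :=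
  IsProbabilityMeasure μ ∧
    ∀ (n : ℕ) (w : Fin n → Fin (s + 1)),
      μ {ω : Word s | ∀ k : Fin n, ω (k : ℕ) = w k} = ENNReal.ofReal (∏ k, p (w k))

/-- The probability parameters `p⃗ ∈ (0,1)^s` with `∑_{i ≤ s} p i < 1`. -/
def ProbVec {s : ℕ} (p : Fin s → ℝ) : Prop :=
  (∀ i, 0 < p i ∧ p i < 1) ∧ ∑ i, p i < 1

/-- The full probability vector `(p_1, …, p_s, p_{s+1})` with `p_{s+1} = 1 - ∑_{i≤s} p_i`. -/
def pfull {s : ℕ} (p : Fin s → ℝ) : Fin (s + 1) → ℝ := fun i =>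
  if h : (i : ℕ) < s then p ⟨i, h⟩ else 1 - ∑ j, p j

/-- The setting of the paper: a family `f_1, …, f_{s+1}` of expanding `C^{1+ε}`
diffeomorphisms of `ℝ` without a common fixed point, extended to `ℝ̄` (with the metric `d`
strongly equivalent to the Euclidean metric on compact subsets of `ℝ`), contracting near
infinity; together with, for each probability vector, the corresponding Bernoulli measure
on the symbol space. -/
structure RDS (s : ℕ) where
  hs : 1 ≤ s
  f : Fin (s + 1) → ℝ → ℝ
  eps : ℝ
  heps : 0 < eps
  smooth : ∀ i, ContDiff ℝ 1 (f i)
  derivHolder : ∀ i, ∃ C : ℝ, ∀ x y : ℝ, |deriv (f i) x - deriv (f i) y| ≤ C * |x - y| ^ eps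
  bij : ∀ i, Function.Bijective (f i)
  lam : ℝ
  hlam : 1 < lam
  expanding : ∀ i x, lam ≤ deriv (f i) x
  noCommonFix : ¬ ∃ x : ℝ, ∀ i, f i x = x
  d : EReal → EReal → ℝ
  d_comm : ∀ x y, d x y = d y x
  d_eq_zero : ∀ x y, d x y = 0 ↔ x = y
  d_triangle : ∀ x y z, d x z ≤ d x y + d y z
  d_top : ∀ u : Set EReal, IsOpen u ↔ ∀ x ∈ u, ∃ δ > 0, ∀ y, d x y < δ → y ∈ u
  d_equiv : ∀ K : Set ℝ, IsCompact K → ∃ C > 0, ∀ x ∈ K, ∀ y ∈ K,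
      C⁻¹ * |x - y| ≤ d (x : EReal) (y : EReal) ∧ d (x : EReal) (y : EReal) ≤ C * |x - y|
  Vp : Set EReal
  Vm : Set EReal
  hVp : Vp ∈ nhds (⊤ : EReal)
  hVm : Vm ∈ nhds (⊥ : EReal)
  contracting : ∀ i, ∃ c : ℝ, c < 1 ∧
      (∀ x ∈ Vp, ∀ y ∈ Vp, d (extE (f i) x) (extE (f i) y) ≤ c * d x y) ∧
      (∀ x ∈ Vm, ∀ y ∈ Vm, d (extE (f i) x) (extE (f i) y) ≤ c * d x y)
  bern : (Fin (s + 1) → ℝ) → Measure (Word s)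
  bern_spec : ∀ p : Fin (s + 1) → ℝ, (∀ i, 0 < p i) → ∑ i, p i = 1 → IsBernoulli p (bern p)

namespace RDS

variable {s : ℕ}

/-- `V = V⁺ ∪ V⁻`, the neighbourhood of `±∞`. -/
def V (S : RDS s) : Set EReal := S.Vp ∪ S.Vm

/-- `f_{ω|n} = f_{ω_n} ∘ ⋯ ∘ f_{ω_1}` on `ℝ̄`. -/
def itE (S : RDS s) (ω : Word s) : ℕ → EReal → EReal
  | 0 => id
  | n + 1 => fun x => extE (S.f (ω n)) (itE S ω n x)

/-- `f_{ω|n} = f_{ω_n} ∘ ⋯ ∘ f_{ω_1}` on `ℝ`. -/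
def itR (S : RDS s) (ω : Word s) : ℕ → ℝ → ℝ
  | 0 => id
  | n + 1 => fun x => S.f (ω n) (itR S ω n x)

/-- `f_w` for a finite word `w` (first letter applied first). -/
def applyWord (S : RDS s) : List (Fin (s + 1)) → EReal → EReal
  | [], x => x
  | i :: w, x => applyWord S w (extE (S.f i) x)

/-- The probability of tending to `+∞`, with respect to a given measure `μ` on the
symbol space. -/
def TfunOf (S : RDS s) (μ : Measure (Word s)) (x : EReal) : ℝ :=
  (μ {ω : Word s | Tendsto (fun n => itE S ω n x) atTop (nhds (⊤ : EReal))}).toReal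

/-- `T_p⃗`, the probability of tending to `+∞`. -/
def Tfun (S : RDS s) (p : Fin (s + 1) → ℝ) : EReal → ℝ :=
  TfunOf S (S.bern p)

/-- `J_ω = ⋂_n (f_{ω|n})⁻¹(ℝ̄ ∖ V)`. -/
def codingSet (S : RDS s) (ω : Word s) : Set EReal :=
  ⋂ n : ℕ, (itE S ω (n + 1)) ⁻¹' (V S)ᶜ

/-- The coding map `π : Σ → J`, characterised by `{π(ω)} = ⋂_n (f_{ω|n})⁻¹(ℝ̄ ∖ V)`. -/
def cmap (S : RDS s) (ω : Word s) : EReal := sInf (codingSet S ω)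

/-- The coding map, viewed as a map into `ℝ`. -/
def cmapR (S : RDS s) (ω : Word s) : ℝ := (cmap S ω).toReal

/-- The distribution function `F(x) = (μ ∘ π⁻¹)((-∞, x])`. -/
def Fdist (S : RDS s) (μ : Measure (Word s)) (x : EReal) : ℝ :=
  (μ {ω : Word s | cmap S ω ≤ x}).toReal

/-- Membership in `C^α(ℝ̄)`: `α`-Hölder continuity with respect to `d`. -/
def MemHolder (S : RDS s) (α : ℝ) (h : EReal → ℝ) : Prop :=
  ∃ K : ℝ, ∀ x y, |h x - h y| ≤ K * S.d x y ^ α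

/-- Complex-valued version of `MemHolder`. -/
def MemHolderC (S : RDS s) (α : ℝ) (h : EReal → ℂ) : Prop :=
  ∃ K : ℝ, ∀ x y, ‖h x - h y‖ ≤ K * S.d x y ^ α

/-- The supremum norm `‖h‖_∞`. -/
def supN (h : EReal → ℝ) : ℝ := ⨆ x : EReal, |h x|

/-- The supremum norm `‖h‖_∞`, complex-valued version. -/
def supNC (h : EReal → ℂ) : ℝ := ⨆ x : EReal, ‖h x‖

/-- The Hölder seminorm `V_α(h)`. -/
def hSemi (S : RDS s) (α : ℝ) (h : EReal → ℝ) : ℝ :=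
  sInf {K : ℝ | 0 ≤ K ∧ ∀ x y, |h x - h y| ≤ K * S.d x y ^ α}

/-- The `α`-Hölder norm `‖h‖_α = V_α(h) + ‖h‖_∞`. -/
def hNorm (S : RDS s) (α : ℝ) (h : EReal → ℝ) : ℝ := hSemi S α h + supN h

/-- The Hölder seminorm, complex-valued version. -/
def hSemiC (S : RDS s) (α : ℝ) (h : EReal → ℂ) : ℝ :=
  sInf {K : ℝ | 0 ≤ K ∧ ∀ x y, ‖h x - h y‖ ≤ K * S.d x y ^ α}

/-- The `α`-Hölder norm, complex-valued version. -/
def hNormC (S : RDS s) (α : ℝ) (h : EReal → ℂ) : ℝ := hSemiC S α h + supNC h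

/-- The transition operator `M_p⃗ h = ∑_i p_i · (h ∘ f_i)`. -/
def Mop (S : RDS s) (p : Fin (s + 1) → ℝ) (h : EReal → ℝ) : EReal → ℝ :=
  fun x => ∑ i, p i * h (extE (S.f i) x)

/-- The complexified transition operator. -/
def MopC (S : RDS s) (p : Fin (s + 1) → ℝ) (h : EReal → ℂ) : EReal → ℂ :=
  fun x => ∑ i, (p i : ℂ) * h (extE (S.f i) x)

/-- A bounded linear operator of the Banach space `C^α(ℝ̄)` (complexified). -/
def IsBddOpC (S : RDS s) (α : ℝ) (T : (EReal → ℂ) → EReal → ℂ) : Prop :=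
  (∀ g h : EReal → ℂ, T (g + h) = T g + T h) ∧
  (∀ (c : ℂ) (h : EReal → ℂ), T (c • h) = c • T h) ∧
  (∀ h, MemHolderC S α h → MemHolderC S α (T h)) ∧
  (∃ K : ℝ, ∀ h, MemHolderC S α h → hNormC S α (T h) ≤ K * hNormC S α h)

/-- Bounded invertibility of an operator on `C^α(ℝ̄)`. -/
def InvOnHolder (S : RDS s) (α : ℝ) (T : (EReal → ℂ) → EReal → ℂ) : Prop :=
  ∃ Tinv : (EReal → ℂ) → EReal → ℂ, IsBddOpC S α Tinv ∧
    (∀ h, MemHolderC S α h → Tinv (T h) = h) ∧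
    (∀ h, MemHolderC S α h → T (Tinv h) = h)

/-- `z` belongs to the spectrum of `T` acting on `C^α(ℝ̄)`. -/
def SpecMem (S : RDS s) (α : ℝ) (T : (EReal → ℂ) → EReal → ℂ) (z : ℂ) : Prop :=
  ¬ InvOnHolder S α (fun h => z • h - T h)

/-- `z` is an eigenvalue of `T` on `C^α(ℝ̄)`. -/
def IsEigenC (S : RDS s) (α : ℝ) (T : (EReal → ℂ) → EReal → ℂ) (z : ℂ) : Prop :=
  ∃ h : EReal → ℂ, MemHolderC S α h ∧ h ≠ 0 ∧ T h = z • h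

/-- The spectral gap property for an operator on `C^α(ℝ̄)`: the spectrum consists of
finitely many eigenvalues of modulus one, and the rest of the spectrum is contained in
a ball of radius strictly less than one. -/
def HasSpectralGap (S : RDS s) (α : ℝ) (T : (EReal → ℂ) → EReal → ℂ) : Prop :=
  IsBddOpC S α T ∧
  ∃ (E : Finset ℂ) (r : ℝ), 0 ≤ r ∧ r < 1 ∧
    (∀ z ∈ E, ‖z‖ = 1 ∧ IsEigenC S α T z ∧ SpecMem S α T z) ∧
    (∀ z : ℂ, SpecMem S α T z → z ∈ E ∨ ‖z‖ ≤ r)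

/-- Unconditional summability with respect to the `α`-Hölder norm. -/
def HolderHasSum (S : RDS s) (α : ℝ) (g : MI s → EReal → ℝ) (h : EReal → ℝ) : Prop :=
  ∀ ε > 0, ∃ F₀ : Finset (MI s), ∀ F : Finset (MI s), F₀ ⊆ F →
    hNorm S α (fun x => (∑ n ∈ F, g n x) - h x) < ε

/-- Real-analyticity of a family `p⃗ ↦ T_p⃗ ∈ C^α(ℝ̄)` on a set `U ⊂ ℝ^s`: local
expansion in a power series converging in the `α`-Hölder norm. -/
def AnalyticFamilyHolder (S : RDS s) (α : ℝ) (U : Set (Fin s → ℝ))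
    (T : (Fin s → ℝ) → EReal → ℝ) : Prop :=
  ∀ q ∈ U, ∃ r > 0, ∃ c : MI s → EReal → ℝ,
    ∀ p : Fin s → ℝ, p ∈ U → (∀ i, |p i - q i| < r) →
      HolderHasSum S α (fun n x => (∏ i, (p i - q i) ^ n i) * c n x) (T p)

/-- Equicontinuity (w.r.t. `d`) of the semigroup `G = ⟨f_1, …, f_{s+1}⟩` on a set `U`. -/
def EquicontG (S : RDS s) (U : Set EReal) : Prop :=
  ∀ x ∈ U, ∀ ε > 0, ∃ δ > 0, ∀ y ∈ U, S.d x y < δ →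
    ∀ w : List (Fin (s + 1)), w ≠ [] → S.d (applyWord S w x) (applyWord S w y) < ε

/-- The Julia set of the semigroup `G = ⟨f_1, …, f_{s+1}⟩`. -/
def Julia (S : RDS s) : Set EReal := {x | ¬ ∃ U ∈ nhds x, EquicontG S U}

/-- The Julia set, viewed inside `ℝ`. -/
def JuliaR (S : RDS s) : Set ℝ := {x : ℝ | (x : EReal) ∈ Julia S}

/-- The potential `φ(ω) = -log |f'_{ω_1}(π(ω))|`. -/
def phi (S : RDS s) (ω : Word s) : ℝ := - Real.log |deriv (S.f (ω 0)) (cmapR S ω)|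

/-- The potential `ψ_p⃗(ω) = log p_{ω_1}`. -/
def psiP {s : ℕ} (p : Fin (s + 1) → ℝ) (ω : Word s) : ℝ := Real.log (p (ω 0))

/-- The Birkhoff sum `S_n u = ∑_{k<n} u ∘ σ^k`. -/
def birk {s : ℕ} (u : Word s → ℝ) (n : ℕ) (ω : Word s) : ℝ :=
  ∑ k ∈ Finset.range n, u (fun m => ω (m + k))

/-- `α_-(p⃗) = inf_ω liminf_n S_n ψ_p⃗(ω) / S_n φ(ω)`, the bottom of the spectrum. -/
def alphaMinus (S : RDS s) (p : Fin (s + 1) → ℝ) : ℝ :=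
  ⨅ ω : Word s, Filter.liminf (fun n => birk (psiP p) n ω / birk (phi S) n ω) atTop

/-- `α_+(p⃗) = sup_ω limsup_n S_n ψ_p⃗(ω) / S_n φ(ω)`. -/
def alphaPlus (S : RDS s) (p : Fin (s + 1) → ℝ) : ℝ :=
  ⨆ ω : Word s, Filter.limsup (fun n => birk (psiP p) n ω / birk (phi S) n ω) atTop

/-- `O` witnesses the open set condition. -/
def IsOSCWitness (S : RDS s) (O : Set ℝ) : Prop :=
  (∃ a b : ℝ, a < b ∧ O = Set.Ioo a b) ∧
  (∀ i, S.f i ⁻¹' O ⊆ O) ∧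
  (∀ i j, i ≠ j → S.f i ⁻¹' O ∩ S.f j ⁻¹' O = ∅)

/-- The open set condition. -/
def OSC (S : RDS s) : Prop := ∃ O, IsOSCWitness S O

/-- `O` witnesses the separating condition. -/
def IsSepWitness (S : RDS s) (O : Set ℝ) : Prop :=
  (∃ a b : ℝ, a < b ∧ O = Set.Ioo a b) ∧
  (∀ i, S.f i ⁻¹' O ⊆ O) ∧
  (∀ i j, i ≠ j → S.f i ⁻¹' (closure O) ∩ S.f j ⁻¹' (closure O) = ∅)

/-- The separating condition. -/
def Sep (S : RDS s) : Prop := ∃ O, IsSepWitness S O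

/-- Partial derivative in the `i`-th coordinate. -/
def pderiv1 {s : ℕ} (i : Fin s) (F : (Fin s → ℝ) → ℝ) : (Fin s → ℝ) → ℝ :=
  fun u => deriv (fun t : ℝ => F (Function.update u i t)) (u i)

/-- Iterated partial derivative `∂^{n_1}_{u_1} ⋯ ∂^{n_s}_{u_s}`. -/
def iterPD {s : ℕ} (n : MI s) (F : (Fin s → ℝ) → ℝ) : (Fin s → ℝ) → ℝ :=
  (List.finRange s).foldl (fun G i => (pderiv1 i)^[n i] G) F

/-- `T` as a function of the `s` free parameters `u ∈ ℝ^s`. -/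
def Tpar (S : RDS s) (u : Fin s → ℝ) (x : EReal) : ℝ := Tfun S (pfull u) x

/-- The generalised Takagi function
`C_n⃗ = ∂^{n_1}_{u_1} ⋯ ∂^{n_s}_{u_s} T_(u)(x) |_{u = p⃗}`. -/
def Cgen (S : RDS s) (p : Fin s → ℝ) (n : MI s) (x : EReal) : ℝ :=
  iterPD n (fun u => Tpar S u x) p

/-- Membership in the vector space `𝒯` of generalised Takagi functions. -/
def memT (S : RDS s) (p : Fin s → ℝ) (C : EReal → ℝ) : Prop :=
  ∃ (F : Finset (MI s)) (β : MI s → ℝ), ∀ x, C x = ∑ n ∈ F, β n * Cgen S p n x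

/-- `C` is a non-trivial element of `𝒯`. -/
def nontrivT (S : RDS s) (p : Fin s → ℝ) (C : EReal → ℝ) : Prop :=
  ∃ (F : Finset (MI s)) (β : MI s → ℝ), (∃ n ∈ F, β n ≠ 0) ∧
    ∀ x, C x = ∑ n ∈ F, β n * Cgen S p n x

/-- The set of Hölder exponents at `x`. -/
def HolSet (C : EReal → ℝ) (x : ℝ) : Set ℝ :=
  {α : ℝ | 0 < α ∧ ∃ M : ℝ, ∀ᶠ y : ℝ in nhdsWithin x {x}ᶜ,
      |C (y : EReal) - C (x : EReal)| ≤ M * |y - x| ^ α}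

/-- The pointwise Hölder exponent
`Hol(C, x) = sup {α > 0 ∣ limsup_{y → x} |C(y) - C(x)|/|y-x|^α < ∞} ∈ [0, ∞]`. -/
def Hol (C : EReal → ℝ) (x : ℝ) : EReal :=
  sSup (insert (0 : EReal) ((fun a : ℝ => (a : EReal)) '' HolSet C x))

/-- The topological pressure of a potential `u` for the full shift `(Σ, σ)`. -/
def pressure (S : RDS s) (u : Word s → ℝ) : ℝ :=
  Filter.limsup (fun n : ℕ => (n : ℝ)⁻¹ * Real.log (∑ w : Fin n → Fin (s + 1),
      Real.exp (⨆ ω : {ω : Word s // ∀ k : Fin n, ω (k : ℕ) = w k}, birk u n ω.1))) atTop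

/-- The convex conjugate (Legendre transform) `t*(u) = sup_β (βu - t(β))`. -/
def tstar (t : ℝ → ℝ) (u : ℝ) : ℝ := sSup {v : ℝ | ∃ β : ℝ, v = β * u - t β}

/-- The cylinder `[ω|n]`. -/
def cyl {s : ℕ} (ω : Word s) (n : ℕ) : Set (Word s) := {τ : Word s | ∀ k < n, τ k = ω k}

/-- `μ` is a (shift-invariant) Gibbs probability measure for the potential `u`. -/
def IsGibbs (S : RDS s) (u : Word s → ℝ) (μ : Measure (Word s)) : Prop :=
  IsProbabilityMeasure μ ∧
  (∀ A : Set (Word s), MeasurableSet A → μ (shiftW ⁻¹' A) = μ A) ∧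
  ∃ c : ℝ, 0 < c ∧ ∀ (ω : Word s) (n : ℕ),
    ENNReal.ofReal (c⁻¹ * Real.exp (birk u n ω - n * pressure S u)) ≤ μ (cyl ω n) ∧
    μ (cyl ω n) ≤ ENNReal.ofReal (c * Real.exp (birk u n ω - n * pressure S u))

/-- `x - e⃗_j` for a multi-index `x`. -/
def elemSub {s : ℕ} (x : MI s) (j : Fin s) : MI s := fun k => if k = j then x k - 1 else x k

/-- The one-step matrix `A₀(ω, 1)` of the matrix cocycle. -/
def A1 {s : ℕ} (p : Fin (s + 1) → ℝ) (i : Fin (s + 1)) : MI s → MI s → ℝ := fun x y =>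
  (if y = x then p i else 0) +
  (if h : (i : ℕ) < s then
      (if x ⟨(i : ℕ), h⟩ ≠ 0 ∧ y = elemSub x ⟨(i : ℕ), h⟩ then ((x ⟨(i : ℕ), h⟩ : ℕ) : ℝ) else 0)
    else - ∑ j : Fin s, (if x j ≠ 0 ∧ y = elemSub x j then ((x j : ℕ) : ℝ) else 0))

/-- The matrix cocycle `A₀(ω, k) = A₀(ω,1) A₀(σω,1) ⋯ A₀(σ^{k-1}ω,1)`. -/
def A0 {s : ℕ} (p : Fin (s + 1) → ℝ) : Word s → ℕ → MI s → MI s → ℝ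
  | _, 0 => fun x y => if x = y then 1 else 0
  | ω, n + 1 => fun x y => ∑' k : MI s, A1 p (ω 0) x k * A0 p (shiftW ω) n k y

/-- The vector `U(a,b) = (C_n⃗(a) - C_n⃗(b))_n⃗`. -/
def Uvec (S : RDS s) (p : Fin s → ℝ) (a b : EReal) : MI s → ℝ :=
  fun n => Cgen S p n a - Cgen S p n b

end RDS

end

namespace FEC

/-! ### Smooth dependence of fixed points -/

section Smooth

open scoped ContDiff

variable {s : ℕ} {α : Type*} [TopologicalSpace α] [DiscreteTopology α]

open Classical in
/-- Weighted pullback operator on bounded functions. -/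
noncomputable def Lop (g : α → α) (M : Set α) :
    BoundedContinuousFunction α ℝ →L[ℝ] BoundedContinuousFunction α ℝ :=
  LinearMap.mkContinuous
    { toFun := fun h => BoundedContinuousFunction.ofNormedAddCommGroupDiscrete
        (fun x => if x ∈ M then h (g x) else 0) ‖h‖ (by
          intro x
          split_ifs
          · exact h.norm_coe_le_norm _
          · simp)
      map_add' := by
        intro h k
        ext x
        simp only [BoundedContinuousFunction.coe_ofNormedAddCommGroupDiscrete,
          BoundedContinuousFunction.coe_add, Pi.add_apply]
        split_ifs <;> simp
      map_smul' := by
        intro c h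
        ext x
        simp }
    1 (by
      intro h
      rw [one_mul]
      refine (BoundedContinuousFunction.norm_le (norm_nonneg _)).2 ?_
      intro x
      simp only [LinearMap.coe_mk, AddHom.coe_mk,
        BoundedContinuousFunction.coe_ofNormedAddCommGroupDiscrete]
      split_ifs
      · exact h.norm_coe_le_norm _
      · simp)

open Classical in
lemma Lop_apply (g : α → α) (M : Set α) (h : BoundedContinuousFunction α ℝ) (x : α) :
    Lop g M h x = if x ∈ M then h (g x) else 0 := rfl

open Classical in
/-- Indicator as a bounded function. -/
noncomputable def Cfun (K : Set α) : BoundedContinuousFunction α ℝ :=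
  BoundedContinuousFunction.ofNormedAddCommGroupDiscrete
    (fun x => if x ∈ K then (1 : ℝ) else 0) 1 (by
      intro x
      split_ifs <;> simp)

open Classical in
lemma Cfun_apply (K : Set α) (x : α) : Cfun K x = if x ∈ K then (1 : ℝ) else 0 := rfl

lemma pfull_contDiff (i : Fin (s + 1)) : ContDiff ℝ ∞ (fun u : Fin s → ℝ => pfull u i) := by
  unfold pfull
  by_cases h : (i : ℕ) < s
  · simp only [h, dite_true]
    fun_prop
  · simp only [h, dite_false]
    fun_prop

lemma abstract_smooth {E : Type*} [NormedAddCommGroup E] [NormedSpace ℝ E] [CompleteSpace E]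
    (W : Set (Fin s → ℝ)) (L : Fin (s + 1) → E →L[ℝ] E) (c : Fin (s + 1) → E)
    (hB : ∀ u ∈ W, ‖∑ i, pfull u i • L i‖ < 1) (φ : E →L[ℝ] ℝ) :
    ContDiffOn ℝ ∞
      (fun u => φ ((Ring.inverse (1 - ∑ i, pfull u i • L i)) (∑ i, pfull u i • c i))) W ∧
    ∀ u ∈ W, ∀ t : E, t - (∑ i, pfull u i • L i) t = ∑ i, pfull u i • c i →
      t = (Ring.inverse (1 - ∑ i, pfull u i • L i)) (∑ i, pfull u i • c i) := by
  constructor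
  · intro u hu
    have hBs : ContDiff ℝ ∞ (fun u : Fin s → ℝ => ∑ i, pfull u i • L i) :=
      ContDiff.sum fun i _ => (pfull_contDiff i).smul contDiff_const
    have hcs : ContDiff ℝ ∞ (fun u : Fin s → ℝ => ∑ i, pfull u i • c i) :=
      ContDiff.sum fun i _ => (pfull_contDiff i).smul contDiff_const
    have hun : IsUnit (1 - ∑ i, pfull u i • L i) := isUnit_one_sub_of_norm_lt_one (hB u hu)
    obtain ⟨v, hv⟩ := hun
    have h1 : ContDiffAt ℝ ∞ (fun u => Ring.inverse (1 - ∑ i, pfull u i • L i)) u := by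
      have := contDiffAt_ringInverse ℝ (n := ∞) v
      rw [hv] at this
      exact this.comp u ((contDiff_const.sub hBs).contDiffAt)
    exact (φ.contDiff.contDiffAt.comp u (h1.clm_apply hcs.contDiffAt)).contDiffWithinAt
  · intro u hu t ht
    have hun : IsUnit (1 - ∑ i, pfull u i • L i) := isUnit_one_sub_of_norm_lt_one (hB u hu)
    have h0 : (1 - ∑ i, pfull u i • L i) t = ∑ i, pfull u i • c i := ht
    rw [← h0]
    have h2 : (Ring.inverse (1 - ∑ i, pfull u i • L i)) ((1 - ∑ i, pfull u i • L i) t) =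
      (Ring.inverse (1 - ∑ i, pfull u i • L i) * (1 - ∑ i, pfull u i • L i)) t := rfl
    rw [h2, Ring.inverse_mul_cancel _ hun]
    rfl

open Classical in
lemma smooth_fixed (g : Fin (s + 1) → α → α) (M K : Fin (s + 1) → Set α)
    (hdisj : ∀ x i j, x ∈ M i → x ∈ M j → i = j)
    (W : Set (Fin s → ℝ))
    (hpos : ∀ u ∈ W, ∀ i, 0 ≤ pfull u i) (hlt : ∀ u ∈ W, ∀ i, pfull u i < 1)
    (T : (Fin s → ℝ) → α → ℝ) (hT : ∀ u ∈ W, ∀ x, |T u x| ≤ 1)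
    (heq : ∀ u ∈ W, ∀ x, T u x = ∑ i, pfull u i *
      ((if x ∈ M i then T u (g i x) else 0) + if x ∈ K i then 1 else 0)) (x : α) :
    ContDiffOn ℝ ∞ (fun u => T u x) W := by
  let B : (Fin s → ℝ) → (BoundedContinuousFunction α ℝ →L[ℝ] BoundedContinuousFunction α ℝ) :=
    fun u => ∑ i, pfull u i • Lop (g i) (M i)
  let c : (Fin s → ℝ) → BoundedContinuousFunction α ℝ := fun u => ∑ i, pfull u i • Cfun (K i)
  have hB : ∀ u ∈ W, ‖B u‖ < 1 := by
    intro u hu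
    obtain ⟨i0, hi0⟩ := Finite.exists_max (fun i => pfull u i)
    refine lt_of_le_of_lt ?_ (hlt u hu i0)
    refine ContinuousLinearMap.opNorm_le_bound _ (hpos u hu i0) ?_
    intro h
    refine (BoundedContinuousFunction.norm_le
      (mul_nonneg (hpos u hu i0) (norm_nonneg _))).2 ?_
    intro z
    have e : (B u h) z = ∑ i, pfull u i * (if z ∈ M i then h (g i z) else 0) := by
      simp [B, BoundedContinuousFunction.sum_apply, Lop_apply]
    rw [e]
    by_cases hz : ∃ i, z ∈ M i
    · obtain ⟨i, hi⟩ := hz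
      rw [Finset.sum_eq_single i]
      · rw [if_pos hi, norm_mul]
        refine mul_le_mul ?_ (h.norm_coe_le_norm _) (norm_nonneg _) (hpos u hu i0)
        rw [Real.norm_eq_abs, abs_of_nonneg (hpos u hu i)]
        exact hi0 i
      · intro j _ hj
        rw [if_neg (fun hj' => hj (hdisj z j i hj' hi)), mul_zero]
      · simp
    · push Not at hz
      simp only [hz, if_false, mul_zero, Finset.sum_const_zero, norm_zero]
      exact mul_nonneg (hpos u hu i0) (norm_nonneg _)
  have hsol : ∀ u ∈ W, T u x = (Ring.inverse (1 - B u) (c u)) x := by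
    intro u hu
    let Tb : BoundedContinuousFunction α ℝ :=
      BoundedContinuousFunction.ofNormedAddCommGroupDiscrete (T u) 1 (hT u hu)
    have h1 : Tb - B u Tb = c u := by
      ext z
      have e1 : (B u Tb) z = ∑ i, pfull u i * (if z ∈ M i then T u (g i z) else 0) := by
        simp [B, BoundedContinuousFunction.sum_apply, Lop_apply, Tb]
      have e2 : (c u) z = ∑ i, pfull u i * (if z ∈ K i then 1 else 0) := by
        simp [c, BoundedContinuousFunction.sum_apply, Cfun_apply]
      have e3 : (Tb - B u Tb) z = T u z - (B u Tb) z := rfl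
      rw [e3, e1, e2, heq u hu z]
      simp only [mul_add, Finset.sum_add_distrib]
      ring
    rw [← (abstract_smooth W (fun i => Lop (g i) (M i)) (fun i => Cfun (K i)) hB
      (BoundedContinuousFunction.evalCLM ℝ x)).2 u hu Tb h1]
    rfl
  have h3 := (abstract_smooth W (fun i => Lop (g i) (M i)) (fun i => Cfun (K i)) hB
      (BoundedContinuousFunction.evalCLM ℝ x)).1
  exact h3.congr (fun u' hu' => hsol u' hu')

end Smooth

/-! ### Iterated partial derivatives -/

section PD

open scoped ContDiff

variable {s : ℕ} {W : Set (Fin s → ℝ)}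

lemma pd_eq (hW : IsOpen W) (i : Fin s) {F : (Fin s → ℝ) → ℝ} (hF : ContDiffOn ℝ ∞ F W)
    {u : Fin s → ℝ} (hu : u ∈ W) :
    HasDerivAt (fun t : ℝ => F (Function.update u i t)) (fderiv ℝ F u (Pi.single i 1)) (u i) := by
  have h1 : HasFDerivAt F (fderiv ℝ F u) u :=
    ((hF.contDiffAt (hW.mem_nhds hu)).differentiableAt (by simp)).hasFDerivAt
  have h2 := hasDerivAt_update u i (u i)
  have h3 : HasFDerivAt F (fderiv ℝ F u) (Function.update u i (u i)) := by
    rw [Function.update_eq_self]; exact h1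
  exact h3.comp_hasDerivAt (u i) h2

lemma pd_apply (hW : IsOpen W) (i : Fin s) {F : (Fin s → ℝ) → ℝ} (hF : ContDiffOn ℝ ∞ F W)
    {u : Fin s → ℝ} (hu : u ∈ W) : RDS.pderiv1 i F u = fderiv ℝ F u (Pi.single i 1) :=
  (pd_eq hW i hF hu).deriv

lemma pd_smooth (hW : IsOpen W) (i : Fin s) {F : (Fin s → ℝ) → ℝ} (hF : ContDiffOn ℝ ∞ F W) :
    ContDiffOn ℝ ∞ (RDS.pderiv1 i F) W := by
  have h1 : ContDiffOn ℝ ∞ (fderiv ℝ F) W := hF.fderiv_of_isOpen hW (by simp)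
  have h2 : ContDiffOn ℝ ∞ (fun u => fderiv ℝ F u (Pi.single i 1)) W :=
    h1.clm_apply contDiffOn_const
  exact h2.congr (fun u hu => pd_apply hW i hF hu)

lemma pd_congr (hW : IsOpen W) (i : Fin s) {F G : (Fin s → ℝ) → ℝ} (h : EqOn F G W) :
    EqOn (RDS.pderiv1 i F) (RDS.pderiv1 i G) W := by
  intro u hu
  unfold RDS.pderiv1
  apply Filter.EventuallyEq.deriv_eq
  have hc : ContinuousAt (fun t : ℝ => Function.update u i t) (u i) :=
    (continuous_const.update i continuous_id).continuousAt
  have : W ∈ 𝓝 (Function.update u i (u i)) := by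
    rw [Function.update_eq_self]; exact hW.mem_nhds hu
  filter_upwards [hc.preimage_mem_nhds this] with t ht
  exact h ht

lemma pd_lin (hW : IsOpen W) (i : Fin s) {F G : (Fin s → ℝ) → ℝ} (hF : ContDiffOn ℝ ∞ F W)
    (hG : ContDiffOn ℝ ∞ G W) (a : ℝ) :
    EqOn (RDS.pderiv1 i (fun u => F u + a * G u))
      (fun u => RDS.pderiv1 i F u + a * RDS.pderiv1 i G u) W := by
  intro u hu
  beta_reduce
  rw [pd_apply hW i hF hu, pd_apply hW i hG hu]
  exact ((pd_eq hW i hF hu).add ((pd_eq hW i hG hu).const_mul a)).deriv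

/-- The multiplier lemma for one derivative. -/
lemma pd_mul (hW : IsOpen W) (i : Fin s) {G : (Fin s → ℝ) → ℝ}
    (hG : ContDiffOn ℝ ∞ G W) (l : (Fin s → ℝ) → ℝ) (c : Fin s → ℝ)
    (hl : ∀ u j, HasDerivAt (fun t : ℝ => l (Function.update u j t)) (c j) (u j)) :
    EqOn (RDS.pderiv1 i (fun u => l u * G u))
      (fun u => l u * RDS.pderiv1 i G u + c i * G u) W := by
  intro u hu
  beta_reduce
  rw [pd_apply hW i hG hu]
  have := ((hl u i).mul (pd_eq hW i hG hu)).deriv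
  simp only [Function.update_eq_self] at this
  refine Eq.trans this ?_
  ring

lemma pdi_smooth (hW : IsOpen W) (i : Fin s) (m : ℕ) {F : (Fin s → ℝ) → ℝ}
    (hF : ContDiffOn ℝ ∞ F W) : ContDiffOn ℝ ∞ ((RDS.pderiv1 i)^[m] F) W := by
  induction m generalizing F with
  | zero => exact hF
  | succ m ih => exact ih (pd_smooth hW i hF)

lemma pdi_congr (hW : IsOpen W) (i : Fin s) (m : ℕ) {F G : (Fin s → ℝ) → ℝ} (h : EqOn F G W) :
    EqOn ((RDS.pderiv1 i)^[m] F) ((RDS.pderiv1 i)^[m] G) W := by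
  induction m generalizing F G with
  | zero => exact h
  | succ m ih => exact ih (pd_congr hW i h)

lemma pdi_lin (hW : IsOpen W) (i : Fin s) (m : ℕ) {F G : (Fin s → ℝ) → ℝ}
    (hF : ContDiffOn ℝ ∞ F W) (hG : ContDiffOn ℝ ∞ G W) (a : ℝ) :
    EqOn ((RDS.pderiv1 i)^[m] (fun u => F u + a * G u))
      (fun u => (RDS.pderiv1 i)^[m] F u + a * (RDS.pderiv1 i)^[m] G u) W := by
  induction m generalizing F G with
  | zero => exact fun u _ => rfl
  | succ m ih =>
    exact (pdi_congr hW i m (pd_lin hW i hF hG a)).trans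
      (ih (pd_smooth hW i hF) (pd_smooth hW i hG))

lemma pdi_mul (hW : IsOpen W) (i : Fin s) (m : ℕ) {G : (Fin s → ℝ) → ℝ}
    (hG : ContDiffOn ℝ ∞ G W) (l : (Fin s → ℝ) → ℝ) (hls : ContDiff ℝ ∞ l) (c : Fin s → ℝ)
    (hl : ∀ u j, HasDerivAt (fun t : ℝ => l (Function.update u j t)) (c j) (u j)) :
    EqOn ((RDS.pderiv1 i)^[m] (fun u => l u * G u))
      (fun u => l u * (RDS.pderiv1 i)^[m] G u +
        (m * c i) * (RDS.pderiv1 i)^[m - 1] G u) W := by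
  induction m generalizing G with
  | zero => intro u _; simp
  | succ m ih =>
    intro u hu
    have h0 := pdi_congr hW i m (pd_mul hW i hG l c hl) hu
    have hG' := pd_smooth hW i hG
    have h1 := pdi_lin hW i m (hls.contDiffOn.mul hG') hG (c i) hu
    have h2 := ih hG' hu
    simp only [Function.iterate_succ_apply, Nat.add_sub_cancel]
    rw [h0]
    refine h1.trans ?_
    beta_reduce
    beta_reduce at h2
    rw [h2]
    rcases m with _ | m
    · simp
    · simp only [Nat.add_sub_cancel, Function.iterate_succ_apply]
      push_cast
      ring

/-- Iterated derivative along a list. -/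
noncomputable def lpd (n : MI s) (L : List (Fin s)) (F : (Fin s → ℝ) → ℝ) : (Fin s → ℝ) → ℝ :=
  L.foldl (fun G i => (RDS.pderiv1 i)^[n i] G) F

lemma lpd_cons (n : MI s) (i : Fin s) (L : List (Fin s)) (F : (Fin s → ℝ) → ℝ) :
    lpd n (i :: L) F = lpd n L ((RDS.pderiv1 i)^[n i] F) := rfl

lemma lpd_congr_index (n n' : MI s) (L : List (Fin s)) (h : ∀ i ∈ L, n i = n' i)
    (F : (Fin s → ℝ) → ℝ) : lpd n L F = lpd n' L F := by
  induction L generalizing F with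
  | nil => rfl
  | cons i L ih =>
    rw [lpd_cons, lpd_cons, h i (by simp), ih (fun j hj => h j (by simp [hj]))]

lemma lpd_smooth (hW : IsOpen W) (n : MI s) (L : List (Fin s)) {F : (Fin s → ℝ) → ℝ}
    (hF : ContDiffOn ℝ ∞ F W) : ContDiffOn ℝ ∞ (lpd n L F) W := by
  induction L generalizing F with
  | nil => exact hF
  | cons i L ih => exact ih (pdi_smooth hW i _ hF)

lemma lpd_congr (hW : IsOpen W) (n : MI s) (L : List (Fin s)) {F G : (Fin s → ℝ) → ℝ}
    (h : EqOn F G W) : EqOn (lpd n L F) (lpd n L G) W := by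
  induction L generalizing F G with
  | nil => exact h
  | cons i L ih => exact ih (pdi_congr hW i _ h)

lemma lpd_lin (hW : IsOpen W) (n : MI s) (L : List (Fin s)) {F G : (Fin s → ℝ) → ℝ}
    (hF : ContDiffOn ℝ ∞ F W) (hG : ContDiffOn ℝ ∞ G W) (a : ℝ) :
    EqOn (lpd n L (fun u => F u + a * G u)) (fun u => lpd n L F u + a * lpd n L G u) W := by
  induction L generalizing F G with
  | nil => exact fun u _ => rfl
  | cons i L ih =>
    exact (lpd_congr hW n L (pdi_lin hW i _ hF hG a)).trans
      (ih (pdi_smooth hW i _ hF) (pdi_smooth hW i _ hG))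

lemma lpd_mul (hW : IsOpen W) (n : MI s) (L : List (Fin s)) (hL : L.Nodup)
    {G : (Fin s → ℝ) → ℝ}
    (hG : ContDiffOn ℝ ∞ G W) (l : (Fin s → ℝ) → ℝ) (hls : ContDiff ℝ ∞ l) (c : Fin s → ℝ)
    (hl : ∀ u j, HasDerivAt (fun t : ℝ => l (Function.update u j t)) (c j) (u j)) :
    EqOn (lpd n L (fun u => l u * G u))
      (fun u => l u * lpd n L G u +
        (L.map (fun j => (n j * c j) * lpd (RDS.elemSub n j) L G u)).sum) W := by
  induction L generalizing G with
  | nil => intro u _; simp [lpd]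
  | cons i L ih =>
    intro u hu
    obtain ⟨hi, hL'⟩ := List.nodup_cons.1 hL
    have hG1 := pdi_smooth hW i (n i) hG
    have hG2 := pdi_smooth hW i (n i - 1) hG
    have h0 := lpd_congr hW n L (pdi_mul hW i (n i) hG l hls c hl) hu
    have h1 := lpd_lin hW n L (hls.contDiffOn.mul hG1) hG2 (n i * c i) hu
    have h2 := ih hL' hG1 hu
    rw [lpd_cons, h0]
    refine h1.trans ?_
    beta_reduce
    beta_reduce at h2
    rw [h2]
    simp only [lpd_cons, List.map_cons, List.sum_cons]
    have e1 : lpd (RDS.elemSub n i) L ((RDS.pderiv1 i)^[RDS.elemSub n i i] G)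
        = lpd n L ((RDS.pderiv1 i)^[n i - 1] G) := by
      rw [lpd_congr_index _ n L]
      · simp [RDS.elemSub]
      · intro j hj
        have : j ≠ i := fun h => hi (h ▸ hj)
        simp [RDS.elemSub, this]
    have e2 : L.map (fun j => (n j * c j) *
          lpd (RDS.elemSub n j) L ((RDS.pderiv1 i)^[RDS.elemSub n j i] G) u)
        = L.map (fun j => (n j * c j) *
          lpd (RDS.elemSub n j) L ((RDS.pderiv1 i)^[n i] G) u) := by
      apply List.map_congr_left
      intro j hj
      have : i ≠ j := fun h => hi (h ▸ hj)
      simp [RDS.elemSub, this]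
    rw [e1, e2]
    ring

end PD

/-! ### Matrix part -/

section Mat

variable {s : ℕ}

/-- Derivative coefficients of `pfull`. -/
noncomputable def cc (i : Fin (s + 1)) (j : Fin s) : ℝ :=
  if (i : ℕ) < s then (if (i : ℕ) = j then 1 else 0) else -1

lemma pfull_hasDeriv (i : Fin (s + 1)) (u : Fin s → ℝ) (j : Fin s) :
    HasDerivAt (fun t : ℝ => pfull (Function.update u j t) i) (cc i j) (u j) := by
  have hu := hasDerivAt_pi.1 (hasDerivAt_update u j (u j))
  unfold cc
  by_cases h : (i : ℕ) < s
  · have e : (fun t : ℝ => pfull (Function.update u j t) i) =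
        fun t : ℝ => Function.update u j t ⟨i, h⟩ := funext fun t => dif_pos h
    rw [e, if_pos h]
    have e2 : (if (i : ℕ) = j then (1 : ℝ) else 0) = Pi.single (M := fun _ => ℝ) j 1 ⟨i, h⟩ := by
      simp [Pi.single_apply, Fin.ext_iff]
    rw [e2]
    exact hu ⟨i, h⟩
  · have e : (fun t : ℝ => pfull (Function.update u j t) i) =
        fun t : ℝ => 1 - ∑ k, Function.update u j t k := funext fun t => dif_neg h
    rw [e, if_neg h]
    have h1 := (HasDerivAt.fun_sum (u := Finset.univ) (fun k _ => hu k)).const_sub 1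
    have e2 : (-1 : ℝ) = -∑ k, Pi.single (M := fun _ : Fin s => ℝ) j 1 k := by
      simp [Pi.single_apply]
    rw [e2]
    exact h1

lemma A1_eq (p : Fin (s + 1) → ℝ) (i : Fin (s + 1)) (n m : MI s) :
    RDS.A1 p i n m = (if m = n then p i else 0) +
      ∑ j, if m = RDS.elemSub n j then (n j * cc i j : ℝ) else 0 := by
  unfold RDS.A1 cc
  congr 1
  by_cases h : (i : ℕ) < s
  · simp only [h, dite_true, if_true]
    rw [Finset.sum_eq_single ⟨(i : ℕ), h⟩]
    · by_cases h0 : n ⟨(i : ℕ), h⟩ = 0 <;> simp [h0]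
    · intro j _ hj
      have : (i : ℕ) ≠ j := fun e => hj (Fin.ext e.symm)
      simp [this]
    · simp
  · simp only [h, dite_false, if_false]
    rw [← Finset.sum_neg_distrib]
    refine Finset.sum_congr rfl fun j _ => ?_
    by_cases h0 : n j = 0
    · simp [h0]
    · by_cases h1 : m = RDS.elemSub n j <;> simp [h0, h1]

lemma A1_hasSum (p : Fin (s + 1) → ℝ) (i : Fin (s + 1)) (n : MI s) (U : MI s → ℝ) :
    HasSum (fun m => RDS.A1 p i n m * U m)
      (p i * U n + ∑ j, (n j * cc i j) * U (RDS.elemSub n j)) := by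
  have h : ∀ (a : ℝ) (k : MI s),
      HasSum (fun m => (if m = k then a else 0) * U m) (a * U k) := by
    intro a k
    have := hasSum_single (f := fun m => (if m = k then a else 0) * U m) k
      (fun m hm => by simp [hm])
    simpa using this
  have h2 := (h (p i) n).add (hasSum_sum (s := Finset.univ)
    (fun j (_ : j ∈ Finset.univ) => h (n j * cc i j) (RDS.elemSub n j)))
  refine h2.congr_fun ?_ 
  intro m
  rw [A1_eq, add_mul, Finset.sum_mul]

lemma A0_succ (p : Fin (s + 1) → ℝ) (ω : Word s) (k : ℕ) (n m : MI s) :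
    RDS.A0 p ω (k + 1) n m = p (ω 0) * RDS.A0 p (shiftW ω) k n m +
      ∑ j, (n j * cc (ω 0) j) * RDS.A0 p (shiftW ω) k (RDS.elemSub n j) m := by
  have : RDS.A0 p ω (k + 1) n m =
    ∑' l : MI s, RDS.A1 p (ω 0) n l * RDS.A0 p (shiftW ω) k l m := rfl
  rw [this]
  exact (A1_hasSum p (ω 0) n (fun l => RDS.A0 p (shiftW ω) k l m)).tsum_eq

/-- Iteration of a one-step functional equation. -/
lemma A0_hasSum {X : Type*} (p : Fin (s + 1) → ℝ) (step : Fin (s + 1) → X → X)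
    (it : Word s → ℕ → X → X) (it0 : ∀ ω z, it ω 0 z = z)
    (itS : ∀ ω k z, it ω (k + 1) z = it (shiftW ω) k (step (ω 0) z))
    (good : Set X) (hback : ∀ i z, step i z ∈ good → z ∈ good)
    (U : X → MI s → ℝ)
    (hU : ∀ i z n, step i z ∈ good → U z n = p i * U (step i z) n +
      ∑ j, (n j * cc i j) * U (step i z) (RDS.elemSub n j))
    (k : ℕ) (ω : Word s) (z : X) (hz : it ω k z ∈ good) (n : MI s) :
    z ∈ good ∧ HasSum (fun m => RDS.A0 p ω k n m * U (it ω k z) m) (U z n) := by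
  induction k generalizing ω z n with
  | zero =>
    rw [it0] at hz ⊢
    refine ⟨hz, ?_⟩
    have := hasSum_single (f := fun m => RDS.A0 p ω 0 n m * U z m) n
      (fun m hm => by simp [RDS.A0, hm.symm])
    simpa [RDS.A0] using this
  | succ k ih =>
    rw [itS] at hz ⊢
    have ih' := ih (shiftW ω) (step (ω 0) z) hz
    have hg := (ih' n).1
    refine ⟨hback _ _ hg, ?_⟩
    rw [hU (ω 0) z n hg]
    have h2 := ((ih' n).2.mul_left (p (ω 0))).add (hasSum_sum (s := Finset.univ)
      (fun j (_ : j ∈ Finset.univ) =>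
        (ih' (RDS.elemSub n j)).2.mul_left (n j * cc (ω 0) j)))
    refine h2.congr_fun ?_
    intro m
    rw [A0_succ, add_mul, Finset.sum_mul]
    simp only [mul_assoc]

end Mat

/-! ### Bernoulli measure -/

section Bern

variable {s : ℕ}

lemma cyl_inter (τ : Word s) (n m : ℕ) :
    RDS.cyl τ n ∩ RDS.cyl τ m = RDS.cyl τ (max n m) := by
  ext ω
  simp only [RDS.cyl, mem_inter_iff, mem_ofPred_eq, lt_max_iff]
  constructor
  · rintro ⟨h1, h2⟩ k (h | h)
    · exact h1 k h
    · exact h2 k h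
  · intro h
    exact ⟨fun k hk => h k (Or.inl hk), fun k hk => h k (Or.inr hk)⟩

lemma cyl_eq {τ ω : Word s} {n : ℕ} (h : τ ∈ RDS.cyl ω n) : RDS.cyl ω n = RDS.cyl τ n := by
  ext x
  simp only [RDS.cyl, mem_ofPred_eq] at *
  exact ⟨fun h' k hk => (h' k hk).trans (h k hk).symm, fun h' k hk => (h' k hk).trans (h k hk)⟩

lemma cyl_pi : IsPiSystem {A : Set (Word s) | ∃ ω n, A = RDS.cyl ω n} := by
  rintro _ ⟨ω, n, rfl⟩ _ ⟨ω', m, rfl⟩ ⟨τ, h1, h2⟩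
  rw [cyl_eq h1, cyl_eq h2, cyl_inter]
  exact ⟨τ, _, rfl⟩

lemma cyl_meas (ω : Word s) (n : ℕ) : MeasurableSet (RDS.cyl ω n) := by
  have : RDS.cyl ω n = ⋂ k : ℕ, ⋂ _ : k < n, (fun τ : Word s => τ k) ⁻¹' {ω k} := by
    ext τ
    simp [RDS.cyl]
  rw [this]
  exact MeasurableSet.iInter fun k => MeasurableSet.iInter fun _ =>
    measurable_pi_apply k (measurableSet_singleton _)

lemma cyl_gen : (inferInstance : MeasurableSpace (Word s)) =
    MeasurableSpace.generateFrom {A : Set (Word s) | ∃ ω n, A = RDS.cyl ω n} := by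
  apply le_antisymm
  · refine iSup_le fun n => ?_
    rw [MeasurableSpace.comap_le_iff_le_map]
    intro B _
    change MeasurableSet[MeasurableSpace.generateFrom _] ((fun τ : Word s => τ n) ⁻¹' B)
    have hfin : (Set.range fun ω : Word s => RDS.cyl ω (n + 1)).Finite := by
      have : (Set.range fun ω : Word s => RDS.cyl ω (n + 1)) ⊆
          Set.range fun w : Fin (n + 1) → Fin (s + 1) =>
            {τ : Word s | ∀ k : Fin (n + 1), τ k = w k} := by
        rintro _ ⟨ω, rfl⟩
        refine ⟨fun k => ω k, ?_⟩
        ext τ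
        simp only [RDS.cyl, mem_ofPred_eq]
        exact ⟨fun h k hk => h ⟨k, hk⟩, fun h k => h k k.2⟩
      exact (Set.finite_range _).subset this
    have e : (fun τ : Word s => τ n) ⁻¹' B =
        ⋃₀ ((fun ω : Word s => RDS.cyl ω (n + 1)) '' ((fun τ : Word s => τ n) ⁻¹' B)) := by
      ext τ
      simp only [mem_sUnion, mem_image, mem_preimage]
      constructor
      · intro h
        exact ⟨_, ⟨τ, h, rfl⟩, fun k _ => rfl⟩
      · rintro ⟨_, ⟨ω, h, rfl⟩, h2⟩
        rw [h2 n (Nat.lt_succ_self n)]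
        exact h
    rw [e]
    refine MeasurableSet.sUnion ((hfin.subset (Set.image_subset_range _ _)).countable) ?_
    rintro _ ⟨ω, _, rfl⟩
    exact MeasurableSpace.measurableSet_generateFrom ⟨ω, n + 1, rfl⟩
  · refine MeasurableSpace.generateFrom_le ?_
    rintro _ ⟨ω, n, rfl⟩
    exact cyl_meas ω n

lemma shiftW_meas : Measurable (shiftW : Word s → Word s) :=
  measurable_pi_lambda _ fun n => measurable_pi_apply (n + 1)

lemma bern_cyl {p : Fin (s + 1) → ℝ} {μ : Measure (Word s)} (h : IsBernoulli p μ)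
    (ω : Word s) (n : ℕ) :
    μ (RDS.cyl ω n) = ENNReal.ofReal (∏ k ∈ Finset.range n, p (ω k)) := by
  have h1 := h.2 n (fun k => ω k)
  rw [Finset.prod_range, ← h1]
  congr 1
  ext τ
  simp only [RDS.cyl, mem_ofPred_eq]
  exact ⟨fun h k => h k k.2, fun h k hk => h ⟨k, hk⟩⟩

lemma bern_shift {p : Fin (s + 1) → ℝ} (hp : ∀ i, 0 ≤ p i) {μ : Measure (Word s)}
    (h : IsBernoulli p μ) (i : Fin (s + 1)) (B : Set (Word s)) (hB : MeasurableSet B) :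
    μ ({ω | ω 0 = i} ∩ shiftW ⁻¹' B) = ENNReal.ofReal (p i) * μ B := by
  have := h.1
  have hi : MeasurableSet {ω : Word s | ω 0 = i} :=
    (measurable_pi_apply (X := fun _ : ℕ => Fin (s + 1)) 0) (measurableSet_singleton i)
  have key : ∀ A : Set (Word s), MeasurableSet A →
      ((μ.restrict {ω | ω 0 = i}).map shiftW) A = μ ({ω | ω 0 = i} ∩ shiftW ⁻¹' A) := by
    intro A hA
    rw [Measure.map_apply shiftW_meas hA, Measure.restrict_apply (shiftW_meas hA), inter_comm]
  have hcyl : ∀ ω n, μ ({ω | ω 0 = i} ∩ shiftW ⁻¹' (RDS.cyl ω n)) =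
      ENNReal.ofReal (p i) * μ (RDS.cyl ω n) := by
    intro ω n
    let ω' : Word s := fun k => Nat.casesOn k i ω
    have e : {ω | ω 0 = i} ∩ shiftW ⁻¹' (RDS.cyl ω n) = RDS.cyl ω' (n + 1) := by
      ext τ
      simp only [RDS.cyl, mem_inter_iff, mem_ofPred_eq, mem_preimage]
      constructor
      · rintro ⟨h0, h1⟩ k hk
        rcases k with _ | k
        · exact h0
        · exact h1 k (by omega)
      · intro h1
        exact ⟨h1 0 (by omega), fun k hk => h1 (k + 1) (by omega)⟩
    rw [e, bern_cyl h, bern_cyl h, Finset.prod_range_succ', mul_comm,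
      ENNReal.ofReal_mul (hp _)]
    rfl
  have huniv : (RDS.cyl (fun _ => (0 : Fin (s + 1))) 0 : Set (Word s)) = univ := by
    ext τ
    simp [RDS.cyl]
  have hext : (μ.restrict {ω | ω 0 = i}).map shiftW = ENNReal.ofReal (p i) • μ := by
    refine ext_of_generate_finite _ cyl_gen cyl_pi ?_ ?_
    · rintro _ ⟨ω, n, rfl⟩
      rw [key _ (cyl_meas ω n), hcyl]
      rfl
    · rw [← huniv, key _ (cyl_meas _ _), hcyl]
      rfl
  rw [← key B hB, hext]
  rfl

end Bern

/-! ### Dynamics -/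

section Dyn

variable {s : ℕ} (S : RDS s)

lemma itE_coe (ω : Word s) (n : ℕ) (x : ℝ) :
    RDS.itE S ω n (x : EReal) = ((RDS.itR S ω n x : ℝ) : EReal) := by
  induction n with
  | zero => rfl
  | succ n ih =>
    have h : RDS.itE S ω (n + 1) (x : EReal) = extE (S.f (ω n)) (RDS.itE S ω n x) := rfl
    rw [h, ih]
    simp [extE, RDS.itR]

lemma itR_shift (ω : Word s) (n : ℕ) (x : ℝ) :
    RDS.itR S ω (n + 1) x = RDS.itR S (shiftW ω) n (S.f (ω 0) x) := by
  induction n with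
  | zero => rfl
  | succ n ih =>
    have h : RDS.itR S ω (n + 1 + 1) x = S.f (ω (n + 1)) (RDS.itR S ω (n + 1) x) := rfl
    rw [h, ih]
    rfl

/-- The escape set. -/
def esc (x : ℝ) : Set (Word s) := {ω | Tendsto (fun n => RDS.itR S ω n x) atTop atTop}

lemma Tpar_eq (u : Fin s → ℝ) (x : ℝ) :
    RDS.Tpar S u (x : EReal) = (S.bern (pfull u) (esc S x)).toReal := by
  unfold RDS.Tpar RDS.Tfun RDS.TfunOf esc
  simp only [itE_coe, EReal.tendsto_coe_nhds_top_iff]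

lemma f_cont (i : Fin (s + 1)) : Continuous (S.f i) := (S.smooth i).continuous

lemma itR_meas (n : ℕ) (x : ℝ) : Measurable (fun ω : Word s => RDS.itR S ω n x) := by
  induction n with
  | zero => exact measurable_const
  | succ n ih =>
    have h : Measurable (fun q : Fin (s + 1) × ℝ => S.f q.1 q.2) :=
      measurable_from_prod_countable_right fun i => (f_cont S i).measurable
    exact h.comp ((measurable_pi_apply n).prodMk ih)

lemma esc_meas (x : ℝ) : MeasurableSet (esc S x) :=
  measurableSet_tendsto atTop fun n => itR_meas S n x

lemma esc_inter (i : Fin (s + 1)) (x : ℝ) :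
    {ω : Word s | ω 0 = i} ∩ esc S x = {ω | ω 0 = i} ∩ shiftW ⁻¹' (esc S (S.f i x)) := by
  ext ω
  simp only [mem_inter_iff, mem_preimage, mem_ofPred_eq, esc]
  refine and_congr_right fun h => ?_
  rw [← tendsto_add_atTop_iff_nat 1]
  simp only [itR_shift, h]

lemma pfull_sum (u : Fin s → ℝ) : ∑ i, pfull u i = 1 := by
  rw [Fin.sum_univ_castSucc]
  simp [pfull]

lemma pfull_pos {u : Fin s → ℝ} (hu : ProbVec u) (i : Fin (s + 1)) : 0 < pfull u i := by
  unfold pfull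
  split_ifs with h
  · exact (hu.1 _).1
  · linarith [hu.2]

lemma pfull_lt_one (hs : 1 ≤ s) {u : Fin s → ℝ} (hu : ProbVec u) (i : Fin (s + 1)) :
    pfull u i < 1 := by
  unfold pfull
  split_ifs with h
  · exact (hu.1 _).2
  · have : 0 < ∑ j, u j :=
      Finset.sum_pos (fun j _ => (hu.1 j).1) ⟨⟨0, hs⟩, Finset.mem_univ _⟩
    linarith

lemma bern_ok {u : Fin s → ℝ} (hu : ProbVec u) : IsBernoulli (pfull u) (S.bern (pfull u)) :=
  S.bern_spec _ (pfull_pos hu) (pfull_sum u)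

lemma Tpar_fun {u : Fin s → ℝ} (hu : ProbVec u) (x : ℝ) :
    RDS.Tpar S u (x : EReal) = ∑ i, pfull u i * RDS.Tpar S u ((S.f i x : ℝ) : EReal) := by
  simp only [Tpar_eq]
  have hb := bern_ok S hu
  have := hb.1
  set μ := S.bern (pfull u)
  have e : μ (esc S x) = ∑ i, μ ({ω : Word s | ω 0 = i} ∩ esc S x) := by
    rw [← measure_biUnion_finset]
    · congr 1
      ext ω
      simp
    · intro i _ j _ hij
      refine Set.disjoint_left.2 ?_
      rintro ω ⟨h1, _⟩ ⟨h2, _⟩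
      exact hij (h1.symm.trans h2)
    · intro i _
      exact ((measurable_pi_apply (X := fun _ : ℕ => Fin (s + 1)) 0)
        (measurableSet_singleton i)).inter (esc_meas S x)
  rw [e, ENNReal.toReal_sum (fun i _ => measure_ne_top _ _)]
  refine Finset.sum_congr rfl fun i _ => ?_
  rw [esc_inter, bern_shift (fun i => (pfull_pos hu i).le) hb i _ (esc_meas S _),
    ENNReal.toReal_mul, ENNReal.toReal_ofReal (pfull_pos hu i).le]

lemma Tpar_bound {u : Fin s → ℝ} (hu : ProbVec u) (x : ℝ) :
    |RDS.Tpar S u (x : EReal)| ≤ 1 := by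
  rw [Tpar_eq]
  have := (bern_ok S hu).1
  rw [abs_of_nonneg ENNReal.toReal_nonneg]
  exact measureReal_le_one

lemma f_expand (i : Fin (s + 1)) {x y : ℝ} (h : x ≤ y) :
    S.lam * (y - x) ≤ S.f i y - S.f i x :=
  mul_sub_le_image_sub_of_le_deriv ((S.smooth i).differentiable (by simp)) (S.expanding i) h

lemma f_mono (i : Fin (s + 1)) : StrictMono (S.f i) := by
  intro x y h
  have h1 := f_expand S i h.le
  have h2 : 0 < S.lam * (y - x) := mul_pos (by linarith [S.hlam]) (by linarith)
  linarith

variable {S} {a b : ℝ}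

lemma f_b (hab : a < b) (hO : RDS.IsOSCWitness S (Ioo a b))
    (i : Fin (s + 1)) : b ≤ S.f i b := by
  by_contra! h
  obtain ⟨v, hv1, hv2⟩ := exists_between (max_lt hab h)
  obtain ⟨c, rfl⟩ := (S.bij i).2 v
  have h1 := hO.2.1 i (show c ∈ S.f i ⁻¹' Ioo a b from ⟨(le_max_left _ _).trans_lt hv1, hv2⟩)
  have h2 := f_mono S i h1.2
  linarith [le_max_right a (S.f i b)]

lemma f_a (hab : a < b) (hO : RDS.IsOSCWitness S (Ioo a b))
    (i : Fin (s + 1)) : S.f i a ≤ a := by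
  by_contra! h
  obtain ⟨v, hv1, hv2⟩ := exists_between (lt_min hab h)
  obtain ⟨c, rfl⟩ := (S.bij i).2 v
  have h1 := hO.2.1 i (show c ∈ S.f i ⁻¹' Ioo a b from ⟨hv1, hv2.trans_le (min_le_left _ _)⟩)
  have h2 := f_mono S i h1.1
  linarith [min_le_right b (S.f i a)]

lemma back (hab : a < b) (hO : RDS.IsOSCWitness S (Ioo a b))
    (i : Fin (s + 1)) (x : ℝ) (h : S.f i x ∈ Icc a b) : x ∈ Icc a b := by
  constructor
  · by_contra! h1
    linarith [f_mono S i h1, f_a hab hO i, h.1]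
  · by_contra! h1
    linarith [f_mono S i h1, f_b hab hO i, h.2]

lemma it_gt (hab : a < b) (hO : RDS.IsOSCWitness S (Ioo a b))
    (ω : Word s) {z : ℝ} (hz : b < z) (n : ℕ) :
    b + S.lam ^ n * (z - b) ≤ RDS.itR S ω n z := by
  induction n with
  | zero => simp [RDS.itR]
  | succ n ih =>
    have hl : 0 < S.lam := by linarith [S.hlam]
    have h0 : 0 < S.lam ^ n * (z - b) := mul_pos (pow_pos hl n) (by linarith)
    have h1 := f_expand S (ω n) (x := b) (y := RDS.itR S ω n z) (by linarith)
    have h2 := f_b hab hO (ω n)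
    have h3 : S.lam * (S.lam ^ n * (z - b)) ≤ S.lam * (RDS.itR S ω n z - b) :=
      mul_le_mul_of_nonneg_left (by linarith) hl.le
    have h4 : RDS.itR S ω (n + 1) z = S.f (ω n) (RDS.itR S ω n z) := rfl
    rw [h4, pow_succ]
    nlinarith

lemma it_lt (hab : a < b) (hO : RDS.IsOSCWitness S (Ioo a b))
    (ω : Word s) {z : ℝ} (hz : z < a) (n : ℕ) : RDS.itR S ω n z ≤ a := by
  induction n with
  | zero => exact hz.le
  | succ n ih =>
    exact ((f_mono S (ω n)).monotone ih).trans (f_a hab hO (ω n))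

lemma T_gt (hab : a < b) (hO : RDS.IsOSCWitness S (Ioo a b))
    {u : Fin s → ℝ} (hu : ProbVec u) {z : ℝ} (hz : b < z) :
    RDS.Tpar S u (z : EReal) = 1 := by
  have := (bern_ok S hu).1
  have e : esc S z = univ := by
    refine eq_univ_of_forall fun ω => ?_
    refine tendsto_atTop_mono (it_gt hab hO ω hz) ?_
    refine tendsto_atTop_add_const_left _ _ ?_
    exact (tendsto_pow_atTop_atTop_of_one_lt S.hlam).atTop_mul_const (by linarith)
  rw [Tpar_eq, e, measure_univ]
  rfl

lemma T_lt (hab : a < b) (hO : RDS.IsOSCWitness S (Ioo a b))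
    {u : Fin s → ℝ} {z : ℝ} (hz : z < a) :
    RDS.Tpar S u (z : EReal) = 0 := by
  have e : esc S z = ∅ := by
    refine eq_empty_of_forall_notMem fun ω h => ?_
    obtain ⟨n, hn⟩ := ((show Tendsto (fun n => RDS.itR S ω n z) atTop atTop from h).eventually
      (eventually_gt_atTop a)).exists
    linarith [it_lt hab hO ω hz n]
  rw [Tpar_eq, e]
  simp

lemma T_end {u : Fin s → ℝ} (hu : ProbVec u) (c v : ℝ)
    (h : ∀ i, S.f i c ≠ c → RDS.Tpar S u ((S.f i c : ℝ) : EReal) = v) :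
    RDS.Tpar S u (c : EReal) = v := by
  obtain ⟨i0, hi0⟩ : ∃ i, S.f i c ≠ c := by
    by_contra! hh
    exact S.noCommonFix ⟨c, hh⟩
  set t := RDS.Tpar S u (c : EReal) with ht
  have h1 : ∑ i, pfull u i * (t - RDS.Tpar S u ((S.f i c : ℝ) : EReal)) = 0 := by
    simp only [mul_sub, Finset.sum_sub_distrib]
    rw [← Tpar_fun S hu, ← Finset.sum_mul, pfull_sum]
    ring
  by_contra hne
  have h2 : ∀ i, (t - RDS.Tpar S u ((S.f i c : ℝ) : EReal)) =
      (t - v) * (if S.f i c = c then 0 else 1) := by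
    intro i
    split_ifs with hi
    · rw [hi]; ring
    · rw [h i hi]; ring
  have h3 : (t - v) * ∑ i, pfull u i * (if S.f i c = c then 0 else 1) = 0 := by
    refine Eq.trans ?_ h1
    rw [Finset.mul_sum]
    refine Finset.sum_congr rfl fun i _ => ?_
    rw [h2]; ring
  have h4 : 0 < ∑ i, pfull u i * (if S.f i c = c then (0 : ℝ) else 1) := by
    refine Finset.sum_pos' (fun i _ => ?_) ⟨i0, Finset.mem_univ _, ?_⟩
    · have := (pfull_pos hu i).le
      split_ifs <;> simp [this]
    · simpa [hi0] using pfull_pos hu i0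
  rcases mul_eq_zero.1 h3 with h5 | h5
  · exact hne (by linarith)
  · linarith

lemma T_ge (hab : a < b) (hO : RDS.IsOSCWitness S (Ioo a b))
    {u : Fin s → ℝ} (hu : ProbVec u) {z : ℝ} (hz : b ≤ z) :
    RDS.Tpar S u (z : EReal) = 1 := by
  rcases hz.lt_or_eq with h | rfl
  · exact T_gt hab hO hu h
  · exact T_end hu _ _ fun i hi =>
      T_gt hab hO hu (lt_of_le_of_ne (f_b hab hO i) (Ne.symm hi))

lemma T_le (hab : a < b) (hO : RDS.IsOSCWitness S (Ioo a b))
    {u : Fin s → ℝ} (hu : ProbVec u) {z : ℝ} (hz : z ≤ a) :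
    RDS.Tpar S u (z : EReal) = 0 := by
  rcases hz.lt_or_eq with h | rfl
  · exact T_lt hab hO h
  · exact T_end hu _ _ fun i hi =>
      T_lt hab hO (lt_of_le_of_ne (f_a hab hO i) hi)

lemma T_other (hab : a < b) (hO : RDS.IsOSCWitness S (Ioo a b))
    {u : Fin s → ℝ} (hu : ProbVec u) {i j : Fin (s + 1)} (hij : i ≠ j) {x y : ℝ}
    (hx : S.f i x ∈ Icc a b) (hy : S.f i y ∈ Icc a b) :
    RDS.Tpar S u ((S.f j x : ℝ) : EReal) = RDS.Tpar S u ((S.f j y : ℝ) : EReal) := by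
  have mi := f_mono S i
  have mj := f_mono S j
  obtain ⟨ai, hai⟩ := (S.bij i).2 a
  obtain ⟨bi, hbi⟩ := (S.bij i).2 b
  obtain ⟨aj, haj⟩ := (S.bij j).2 a
  obtain ⟨bj, hbj⟩ := (S.bij j).2 b
  have hi : ai < bi := mi.lt_iff_lt.1 (by rw [hai, hbi]; exact hab)
  have hj : aj < bj := mj.lt_iff_lt.1 (by rw [haj, hbj]; exact hab)
  have hx1 : ai ≤ x := mi.le_iff_le.1 (by rw [hai]; exact hx.1)
  have hx2 : x ≤ bi := mi.le_iff_le.1 (by rw [hbi]; exact hx.2)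
  have hy1 : ai ≤ y := mi.le_iff_le.1 (by rw [hai]; exact hy.1)
  have hy2 : y ≤ bi := mi.le_iff_le.1 (by rw [hbi]; exact hy.2)
  have hor : bj ≤ ai ∨ bi ≤ aj := by
    by_contra! hh
    obtain ⟨c, hc1, hc2⟩ := exists_between
      (show max ai aj < min bi bj from max_lt (lt_min hi hh.1) (lt_min hh.2 hj))
    rw [max_lt_iff] at hc1
    rw [lt_min_iff] at hc2
    have q : c ∈ S.f i ⁻¹' Ioo a b ∩ S.f j ⁻¹' Ioo a b :=
      ⟨⟨by rw [← hai]; exact mi hc1.1, by rw [← hbi]; exact mi hc2.1⟩,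
        ⟨by rw [← haj]; exact mj hc1.2, by rw [← hbj]; exact mj hc2.2⟩⟩
    rw [hO.2.2 i j hij] at q
    exact q
  rcases hor with h | h
  · have h1 : b ≤ S.f j x := by rw [← hbj]; exact mj.monotone (h.trans hx1)
    have h2 : b ≤ S.f j y := by rw [← hbj]; exact mj.monotone (h.trans hy1)
    rw [T_ge hab hO hu h1, T_ge hab hO hu h2]
  · have h1 : S.f j x ≤ a := by rw [← haj]; exact mj.monotone (hx2.trans h)
    have h2 : S.f j y ≤ a := by rw [← haj]; exact mj.monotone (hy2.trans h)
    rw [T_le hab hO hu h1, T_le hab hO hu h2]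

lemma T_step (hab : a < b) (hO : RDS.IsOSCWitness S (Ioo a b))
    {u : Fin s → ℝ} (hu : ProbVec u) (i : Fin (s + 1)) {x y : ℝ}
    (hx : S.f i x ∈ Icc a b) (hy : S.f i y ∈ Icc a b) :
    RDS.Tpar S u (x : EReal) - RDS.Tpar S u (y : EReal) = pfull u i *
      (RDS.Tpar S u ((S.f i x : ℝ) : EReal) - RDS.Tpar S u ((S.f i y : ℝ) : EReal)) := by
  rw [Tpar_fun S hu x, Tpar_fun S hu y, ← Finset.sum_sub_distrib, Finset.sum_eq_single i]
  · ring
  · intro j _ hj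
    rw [T_other hab hO hu hj.symm hx hy, sub_self]
  · simp

open scoped ContDiff in
lemma T_smooth (hab : a < b) (hO : RDS.IsOSCWitness S (Ioo a b))
    (x : ℝ) :
    ContDiffOn ℝ ∞ (fun u : Fin s → ℝ => RDS.Tpar S u (x : EReal)) {u | ProbVec u} := by
  let _ : TopologicalSpace (ULift.{0} ℝ) := ⊥
  have _ : DiscreteTopology (ULift.{0} ℝ) := ⟨rfl⟩
  refine smooth_fixed (α := ULift.{0} ℝ) (fun i z => ⟨S.f i z.down⟩)
    (fun i => {z | S.f i z.down ∈ Ioo a b})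
    (fun i => {z | b ≤ S.f i z.down}) ?_ {u | ProbVec u}
    (fun u hu i => (pfull_pos hu i).le) (fun u hu i => pfull_lt_one S.hs hu i)
    (fun u z => RDS.Tpar S u ((z.down : ℝ) : EReal)) (fun u hu z => Tpar_bound S hu z.down)
    ?_ ⟨x⟩
  · intro z i j h1 h2
    by_contra hij
    have q : z.down ∈ S.f i ⁻¹' Ioo a b ∩ S.f j ⁻¹' Ioo a b := ⟨h1, h2⟩
    rw [hO.2.2 i j hij] at q
    exact q
  · intro u hu z
    refine (Tpar_fun S hu z.down).trans (Finset.sum_congr rfl fun i _ => ?_)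
    congr 1
    simp only [mem_ofPred_eq]
    rcases le_or_gt b (S.f i z.down) with h | h
    · rw [if_neg (fun h' => absurd h'.2 (not_lt.2 h)), if_pos h, T_ge hab hO hu h, zero_add]
    · rw [if_neg (not_le.2 h), add_zero]
      rcases le_or_gt (S.f i z.down) a with h' | h'
      · rw [if_neg (fun h'' => absurd h''.1 (not_lt.2 h')), T_le hab hO hu h']
      · rw [if_pos ⟨h', h⟩]

end Dyn

lemma probVec_open {s : ℕ} : IsOpen {u : Fin s → ℝ | ProbVec u} := by
  have : {u : Fin s → ℝ | ProbVec u} =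
      (⋂ i, {u : Fin s → ℝ | 0 < u i} ∩ {u | u i < 1}) ∩ {u | ∑ i, u i < 1} := by
    ext u
    simp [ProbVec]
  rw [this]
  refine IsOpen.inter (isOpen_iInter_of_finite fun i => IsOpen.inter ?_ ?_) ?_
  · exact isOpen_lt continuous_const (continuous_apply i)
  · exact isOpen_lt (continuous_apply i) continuous_const
  · exact isOpen_lt (continuous_finsetSum _ fun i _ => continuous_apply i) continuous_const

lemma U_step {s : ℕ} {S : RDS s} {a b : ℝ} (hab : a < b) (hO : RDS.IsOSCWitness S (Ioo a b))
    {p : Fin s → ℝ} (hp : ProbVec p) (i : Fin (s + 1)) {x y : ℝ}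
    (hx : S.f i x ∈ Icc a b) (hy : S.f i y ∈ Icc a b) (n : MI s) :
    RDS.Uvec S p (x : EReal) (y : EReal) n =
      pfull p i * RDS.Uvec S p ((S.f i x : ℝ) : EReal) ((S.f i y : ℝ) : EReal) n +
      ∑ j, (n j * cc i j) *
        RDS.Uvec S p ((S.f i x : ℝ) : EReal) ((S.f i y : ℝ) : EReal) (RDS.elemSub n j) := by
  have hW : IsOpen {u : Fin s → ℝ | ProbVec u} := probVec_open
  have hU : ∀ (x y : ℝ) (m : MI s), RDS.Uvec S p (x : EReal) (y : EReal) m =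
      lpd m (List.finRange s)
        (fun u => RDS.Tpar S u (x : EReal) + (-1) * RDS.Tpar S u (y : EReal)) p := by
    intro x y m
    rw [lpd_lin hW m (List.finRange s) (T_smooth hab hO x) (T_smooth hab hO y) (-1) hp]
    change lpd m (List.finRange s) (fun u => RDS.Tpar S u (x : EReal)) p -
      lpd m (List.finRange s) (fun u => RDS.Tpar S u (y : EReal)) p = _
    ring
  rw [hU]
  simp only [hU]
  have hG := (T_smooth hab hO (S.f i x)).add
    (contDiffOn_const (c := (-1 : ℝ)) |>.mul (T_smooth hab hO (S.f i y)))
  have e := lpd_congr hW n (List.finRange s)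
    (F := fun u => RDS.Tpar S u (x : EReal) + (-1) * RDS.Tpar S u (y : EReal))
    (G := fun u => pfull u i * (RDS.Tpar S u ((S.f i x : ℝ) : EReal) +
      (-1) * RDS.Tpar S u ((S.f i y : ℝ) : EReal)))
    (fun u hu => by
      have := T_step hab hO hu i hx hy
      beta_reduce
      linarith) hp
  rw [e, lpd_mul hW n (List.finRange s) (List.nodup_finRange s) hG (fun u => pfull u i)
    (pfull_contDiff i) (cc i) (fun u j => pfull_hasDeriv i u j) hp]
  beta_reduce
  rw [← List.ofFn_eq_map, List.sum_ofFn]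

end FEC

/-- **Lemma (functional equation via the matrix cocycle, Lemma 3.5).**
Suppose `(f_i)` satisfies the open set condition. Let `k ∈ ℕ`, `ω ∈ I^k` and
`x, y ∈ f_ω⁻¹(Ō)`. Then `U(x,y) = A₀(ω̄, k) U(f_ω(x), f_ω(y))`, where `ω̄ ∈ Σ` is the
periodic extension of `ω`. -/
theorem functional_equation_cocycle {s : ℕ} (S : RDS s) (p : Fin s → ℝ) (hp : ProbVec p)
    (O : Set ℝ) (hO : RDS.IsOSCWitness S O) (k : ℕ) (hk : 0 < k)
    (w : Fin k → Fin (s + 1)) (ωb : Word s)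
    (hωb : ∀ m : ℕ, ωb m = w ⟨m % k, Nat.mod_lt m hk⟩) (x y : ℝ)
    (hx : RDS.itR S ωb k x ∈ closure O) (hy : RDS.itR S ωb k y ∈ closure O) :
    ∀ nn : MI s,
      RDS.Uvec S p (x : EReal) (y : EReal) nn =
        ∑' m : MI s, RDS.A0 (pfull p) ωb k nn m *
          RDS.Uvec S p ((RDS.itR S ωb k x : ℝ) : EReal)
            ((RDS.itR S ωb k y : ℝ) : EReal) m := by
  intro nn
  obtain ⟨⟨a, b, hab, rfl⟩, hO2⟩ := id hO
  rw [closure_Ioo hab.ne] at hx hy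
  have := (FEC.A0_hasSum (X := ℝ × ℝ) (pfull p) (fun i z => (S.f i z.1, S.f i z.2))
    (fun ω k z => (RDS.itR S ω k z.1, RDS.itR S ω k z.2)) (fun ω z => rfl)
    (fun ω k z => by simp only [FEC.itR_shift])
    {z | z.1 ∈ Icc a b ∧ z.2 ∈ Icc a b}
    (fun i z h => ⟨FEC.back hab hO i _ h.1, FEC.back hab hO i _ h.2⟩)
    (fun z => RDS.Uvec S p ((z.1 : ℝ) : EReal) ((z.2 : ℝ) : EReal))
    (fun i z n h => FEC.U_step hab hO hp i h.1 h.2 n) k ωb (x, y) ⟨hx, hy⟩ nn).2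
  exact this.tsum_eq.symm
end

section
/- Suppose (f_i)_{i∈I} satisfies the open set condition, and let x₀ ∈ J. Then there exist a, b ∈ (J ∩ O)∖G(x₀) with T_p⃗(a) ≠ T_p⃗(b), and b can be chosen arbitrarily close to a: for every ε > 0 there exist such a, b with d(a,b) < ε. -/
open MeasureTheory Filter Topology Set

namespace RDS
open Real

variable {s : ℕ}

lemma aux_expand (S : RDS s) (i : Fin (s+1)) {x y : ℝ} (h : x ≤ y) :
    S.lam * (y - x) ≤ S.f i y - S.f i x :=
  mul_sub_le_image_sub_of_le_deriv ((S.smooth i).differentiable (by norm_num))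
    (S.expanding i) h

lemma aux_mono (S : RDS s) (i : Fin (s+1)) : StrictMono (S.f i) := by
  intro x y h
  have := aux_expand S i h.le
  have h1 := S.hlam
  nlinarith

lemma aux_it_expand (S : RDS s) (ω : Word s) (n : ℕ) {x y : ℝ} (h : x ≤ y) :
    S.lam ^ n * (y - x) ≤ itR S ω n y - itR S ω n x := by
  induction n with
  | zero => simp [itR]
  | succ n ih =>
    have h1 := S.hlam
    have h0 : 0 ≤ S.lam ^ n * (y - x) := by
      have : 0 ≤ y - x := by linarith
      positivity
    have := aux_expand S (ω n) (x := itR S ω n x) (y := itR S ω n y) (by linarith)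
    simp only [itR]
    calc S.lam ^ (n+1) * (y - x) = S.lam * (S.lam ^ n * (y - x)) := by ring
      _ ≤ S.lam * (itR S ω n y - itR S ω n x) := by gcongr
      _ ≤ _ := this

lemma aux_itE (S : RDS s) (ω : Word s) (n : ℕ) (x : ℝ) :
    itE S ω n (x : EReal) = ((itR S ω n x : ℝ) : EReal) := by
  induction n with
  | zero => simp [itR, itE]
  | succ n ih => simp [itR, itE, ih, extE]

lemma aux_applyWord_append (S : RDS s) (l : List (Fin (s+1))) (i : Fin (s+1)) (x : EReal) :
    applyWord S (l ++ [i]) x = extE (S.f i) (applyWord S l x) := by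
  induction l generalizing x with
  | nil => rfl
  | cons j l ih => simp [applyWord, ih]

lemma aux_applyWord (S : RDS s) (ω : Word s) (n : ℕ) (x : EReal) :
    applyWord S ((List.range n).map ω) x = itE S ω n x := by
  induction n with
  | zero => rfl
  | succ n ih =>
    rw [List.range_succ, List.map_append, List.map_singleton, aux_applyWord_append, ih]
    rfl

lemma aux_it_cont (S : RDS s) (ω : Word s) (n : ℕ) : Continuous (itR S ω n) := by
  induction n with
  | zero => exact continuous_id
  | succ n ih => exact (S.smooth (ω n)).continuous.comp ih

lemma aux_it_surj (S : RDS s) (ω : Word s) (n : ℕ) : Function.Surjective (itR S ω n) := by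
  induction n with
  | zero => exact Function.surjective_id
  | succ n ih => exact (S.bij (ω n)).2.comp ih

lemma aux_it_congr (S : RDS s) (ω τ : Word s) (n : ℕ) (h : ∀ k < n, ω k = τ k) (x : ℝ) :
    itR S ω n x = itR S τ n x := by
  induction n with
  | zero => rfl
  | succ n ih =>
    simp only [itR]
    rw [ih (fun k hk => h k (by omega)), h n (by omega)]

lemma aux_left (S : RDS s) {α β : ℝ} (hab : α < β)
    (h : ∀ i, S.f i ⁻¹' Ioo α β ⊆ Ioo α β) (i : Fin (s+1)) : S.f i α ≤ α := by
  by_contra! hc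
  obtain ⟨z, hz1, hz2⟩ := exists_between (lt_min hc hab)
  obtain ⟨y, rfl⟩ := (S.bij i).2 z
  have := h i (show y ∈ _ from ⟨hz1, hz2.trans_le (min_le_right _ _)⟩)
  have h2 := aux_mono S i this.1
  have := hz2.trans_le (min_le_left _ _)
  linarith

lemma aux_right (S : RDS s) {α β : ℝ} (hab : α < β)
    (h : ∀ i, S.f i ⁻¹' Ioo α β ⊆ Ioo α β) (i : Fin (s+1)) : β ≤ S.f i β := by
  by_contra! hc
  obtain ⟨z, hz1, hz2⟩ := exists_between (max_lt hc hab)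
  obtain ⟨y, rfl⟩ := (S.bij i).2 z
  have := h i (show y ∈ _ from ⟨(le_max_right _ _).trans_lt hz1, hz2⟩)
  have h2 := aux_mono S i this.2
  have := (le_max_left _ _).trans_lt hz1
  linarith

lemma aux_LR (S : RDS s) {α β : ℝ} (hab : α < β)
    (h : ∀ i j, i ≠ j → S.f i ⁻¹' Ioo α β ∩ S.f j ⁻¹' Ioo α β = ∅) :
    ∃ L R : Fin (s+1), ∀ x, S.f L x ≤ β → S.f R x ≤ α := by
  have hs := S.hs
  let i : Fin (s+1) := ⟨0, by omega⟩
  let j : Fin (s+1) := ⟨1, by omega⟩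
  have hij : i ≠ j := by simp [i, j]
  obtain ⟨c0, hc0⟩ := (S.bij i).2 α
  obtain ⟨d0, hd0⟩ := (S.bij i).2 β
  obtain ⟨c1, hc1⟩ := (S.bij j).2 α
  obtain ⟨d1, hd1⟩ := (S.bij j).2 β
  have mi := aux_mono S i
  have mj := aux_mono S j
  have h0 : c0 < d0 := mi.lt_iff_lt.1 (by rw [hc0, hd0]; exact hab)
  have h1 : c1 < d1 := mj.lt_iff_lt.1 (by rw [hc1, hd1]; exact hab)
  have key : d0 ≤ c1 ∨ d1 ≤ c0 := by
    by_contra! hc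
    obtain ⟨z, hz1, hz2⟩ := exists_between
      (show max c0 c1 < min d0 d1 from max_lt (lt_min h0 hc.2) (lt_min hc.1 h1))
    rw [max_lt_iff] at hz1
    rw [lt_min_iff] at hz2
    have : z ∈ S.f i ⁻¹' Ioo α β ∩ S.f j ⁻¹' Ioo α β := by
      refine ⟨⟨?_, ?_⟩, ⟨?_, ?_⟩⟩
      · rw [← hc0]; exact mi hz1.1
      · rw [← hd0]; exact mi hz2.1
      · rw [← hc1]; exact mj hz1.2
      · rw [← hd1]; exact mj hz2.2
    rw [h i j hij] at this
    exact this
  rcases key with k | k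
  · refine ⟨i, j, fun x hx => ?_⟩
    rw [← hd0, mi.le_iff_le] at hx
    rw [← hc1, mj.le_iff_le]; linarith
  · refine ⟨j, i, fun x hx => ?_⟩
    rw [← hd1, mj.le_iff_le] at hx
    rw [← hc0, mi.le_iff_le]; linarith

lemma aux_exists_pt (S : RDS s) {α β : ℝ} (hab : α < β)
    (hl : ∀ i, S.f i α ≤ α) (hr : ∀ i, β ≤ S.f i β) (ω : Word s) :
    ∃ x, ∀ n, itR S ω n x ∈ Icc α β := by
  have := IsCompact.nonempty_iInter_of_sequence_nonempty_isCompact_isClosed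
    (fun n => itR S ω n ⁻¹' Icc α β) ?_ ?_ ?_ ?_
  · obtain ⟨x, hx⟩ := this
    exact ⟨x, fun n => mem_iInter.1 hx n⟩
  · intro n x hx
    simp only [mem_preimage, itR, mem_Icc] at hx ⊢
    constructor
    · exact (aux_mono S (ω n)).le_iff_le.1 ((hl _).trans hx.1)
    · exact (aux_mono S (ω n)).le_iff_le.1 (hx.2.trans (hr _))
  · intro n
    obtain ⟨x, hx⟩ := aux_it_surj S ω n α
    exact ⟨x, by simp [hx, hab.le]⟩
  · simpa [itR] using (isCompact_Icc : IsCompact (Icc α β))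
  · intro n
    exact isClosed_Icc.preimage (aux_it_cont S ω n)

lemma aux_d_nonneg (S : RDS s) (x y : EReal) : 0 ≤ S.d x y := by
  have h := S.d_triangle x y x
  rw [(S.d_eq_zero x x).2 rfl, S.d_comm y x] at h
  linarith

lemma aux_ball (S : RDS s) (x : EReal) {r : ℝ} (hr : 0 < r) : {y | S.d x y < r} ∈ 𝓝 x := by
  apply IsOpen.mem_nhds
  · rw [S.d_top]
    intro y hy
    refine ⟨r - S.d x y, by simpa using hy, fun z hz => ?_⟩
    have := S.d_triangle x y z
    simp only [mem_setOf_eq]; linarith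
  · simpa [(S.d_eq_zero x x).2 rfl] using hr

/-- orbits above a bounded orbit go to `+∞` -/
lemma aux_julia (S : RDS s) {α β : ℝ} (ω : Word s) (x : ℝ)
    (hx : ∀ n, itR S ω n x ∈ Icc α β) : (x : EReal) ∈ Julia S := by
  rintro ⟨U, hU, hE⟩
  have hop : IsOpen (Ioi (β : EReal)) := isOpen_Ioi
  obtain ⟨r, hr, hr'⟩ := (S.d_top _).1 hop ⊤ (EReal.coe_lt_top β)
  obtain ⟨δ, hδ, h⟩ := hE x (mem_of_mem_nhds hU) (r/2) (by positivity)
  have hn : (fun y : ℝ => (y : EReal)) ⁻¹' (U ∩ {y | S.d x y < δ}) ∈ 𝓝 x :=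
    continuous_coe_real_ereal.continuousAt.preimage_mem_nhds
      (inter_mem hU (aux_ball S x hδ))
  obtain ⟨y, hy, hxy⟩ : ∃ y, y ∈ (fun y : ℝ => (y : EReal)) ⁻¹' (U ∩ {y | S.d x y < δ}) ∧ x < y := by
    obtain ⟨e, he, hb⟩ := Metric.mem_nhds_iff.1 hn
    refine ⟨x + e/2, hb ?_, by linarith⟩
    simp [Real.dist_eq, abs_of_pos he]
    exact he
  have ht : Tendsto (fun n => itE S ω n (y : EReal)) atTop (𝓝 ⊤) := by
    simp only [aux_itE]
    rw [EReal.tendsto_coe_nhds_top_iff]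
    have h1 : Tendsto (fun n => α + S.lam ^ n * (y - x)) atTop atTop :=
      tendsto_atTop_add_const_left _ _
        ((tendsto_pow_atTop_atTop_of_one_lt S.hlam).atTop_mul_const (by linarith))
    refine tendsto_atTop_mono (fun n => ?_) h1
    have := aux_it_expand S ω n hxy.le
    have := (hx n).1
    linarith
  obtain ⟨n, hn1, hn2⟩ := ((ht.eventually (aux_ball S ⊤ (half_pos hr))).and
    (eventually_ge_atTop 1)).exists
  have hw := h y hy.1 hy.2 ((List.range n).map ω) (by simp; omega)
  rw [aux_applyWord, aux_applyWord] at hw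
  have h2 : ¬ S.d ⊤ (itE S ω n x) < r := by
    intro hc
    have := hr' _ hc
    rw [aux_itE, mem_Ioi, EReal.coe_lt_coe_iff] at this
    have := (hx n).2
    linarith
  have h3 := S.d_triangle ⊤ (itE S ω n y) (itE S ω n x)
  rw [S.d_comm (itE S ω n y)] at h3
  have hn3 : S.d ⊤ (itE S ω n y) < r / 2 := hn1
  linarith

/-- coding of a binary sequence by blocks `LR`, `RL` -/
def auxCode (L R : Fin (s+1)) (τ : ℕ → Bool) : Word s := fun n =>
  if n % 2 = 0 then (if τ (n/2) then L else R) else (if τ (n/2) then R else L)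

lemma auxCode_even (L R : Fin (s+1)) (τ : ℕ → Bool) (n : ℕ) :
    auxCode L R τ (2*n) = if τ n then L else R := by
  simp [auxCode]

lemma auxCode_odd (L R : Fin (s+1)) (τ : ℕ → Bool) (n : ℕ) :
    auxCode L R τ (2*n+1) = if τ n then R else L := by
  have h1 : (2*n+1) % 2 = 1 := by omega
  have h2 : (2*n+1) / 2 = n := by omega
  simp [auxCode, h1, h2]

lemma aux_even_mem (S : RDS s) {α β : ℝ} (hab : α < β)
    (hl : ∀ i, S.f i α ≤ α) (hr : ∀ i, β ≤ S.f i β) (L R : Fin (s+1))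
    (hLR : ∀ x, S.f L x ≤ β → S.f R x ≤ α) (τ : ℕ → Bool) (x : ℝ)
    (hx : ∀ n, itR S (auxCode L R τ) n x ∈ Icc α β) (n : ℕ) :
    itR S (auxCode L R τ) (2*n) x ∈ Ioo α β := by
  have hRα : S.f R α < α := by
    obtain ⟨y, hy⟩ := (S.bij L).2 β
    have : α < y := (aux_mono S L).lt_iff_lt.1 (by have := hl L; linarith)
    exact (aux_mono S R this).trans_le (hLR y hy.le)
  have hLβ : β < S.f L β := by
    obtain ⟨y, hy⟩ := (S.bij L).2 β
    have h1 := hLR y hy.le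
    have : y < β := (aux_mono S R).lt_iff_lt.1 (by have := hr R; linarith)
    have := aux_mono S L this
    linarith
  have h0 := hx (2*n)
  have h1 := hx (2*n+1)
  have h2 := hx (2*n+2)
  simp only [itR, auxCode_even, auxCode_odd] at h1 h2
  refine ⟨lt_of_le_of_ne h0.1 fun hc => ?_, lt_of_le_of_ne h0.2 fun hc => ?_⟩
  · rw [← hc] at h1 h2
    cases hτ : τ n
    · simp [hτ] at h1; linarith [h1.1]
    · simp [hτ] at h1 h2
      have : S.f L α = α := le_antisymm (hl L) h1.1
      rw [this] at h2
      linarith [h2.1]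
  · rw [hc] at h1 h2
    cases hτ : τ n
    · simp [hτ] at h1 h2
      have : S.f R β = β := le_antisymm h1.2 (hr R)
      rw [this] at h2
      linarith [h2.2]
    · simp [hτ] at h1; linarith [h1.2]

lemma aux_inj (S : RDS s) {α β : ℝ} (hab : α < β)
    (hl : ∀ i, S.f i α ≤ α) (hr : ∀ i, β ≤ S.f i β) (L R : Fin (s+1))
    (hLR : ∀ x, S.f L x ≤ β → S.f R x ≤ α) (τ τ' : ℕ → Bool) (x : ℝ)
    (hx : ∀ n, itR S (auxCode L R τ) n x ∈ Icc α β)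
    (hx' : ∀ n, itR S (auxCode L R τ') n x ∈ Icc α β) : τ = τ' := by
  have main : ∀ (τ τ' : ℕ → Bool) (n : ℕ), (∀ n, itR S (auxCode L R τ) n x ∈ Icc α β) →
      (∀ n, itR S (auxCode L R τ') n x ∈ Icc α β) → (∀ k < n, τ k = τ' k) →
      τ n = true → τ' n = false → False := by
    intro τ τ' n hx hx' hk h1 h2
    have e : itR S (auxCode L R τ) (2*n) x = itR S (auxCode L R τ') (2*n) x := by
      apply aux_it_congr
      intro k hk'
      simp only [auxCode]
      rw [hk (k/2) (by omega)]
    have a1 := (hx (2*n+1)).2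
    have a2 := (aux_even_mem S hab hl hr L R hLR τ' x hx' (n+1)).1
    rw [show 2*(n+1) = 2*n+1+1 by ring] at a2
    simp only [itR, auxCode_even, auxCode_odd, h1, h2, e] at a1 a2
    simp at a1 a2
    have a3 := hLR _ a1
    have := (aux_mono S L).monotone a3
    linarith [hl L]
  funext n
  induction n using Nat.strong_induction_on with
  | _ n ih =>
    cases h1 : τ n <;> cases h2 : τ' n
    · rfl
    · exact (main τ' τ n hx' hx (fun k hk => (ih k hk).symm) h2 h1).elim
    · exact (main τ τ' n hx hx' ih h1 h2).elim
    · rfl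

lemma aux_T_lt (S : RDS s) (q : Fin (s+1) → ℝ) (hq : ∀ i, 0 < q i) (μ : Measure (Word s))
    (hμ : IsBernoulli q μ) {α β : ℝ}
    (hl : ∀ i, S.f i α ≤ α) (hr : ∀ i, β ≤ S.f i β) (L R : Fin (s+1))
    (hLR : ∀ x, S.f L x ≤ β → S.f R x ≤ α) (τ : ℕ → Bool) (a b : ℝ)
    (ha : ∀ n, itR S (auxCode L R τ) n a ∈ Icc α β) (hab : a < b) :
    TfunOf S μ a < TfunOf S μ b := by
  haveI := hμ.1
  have hlam := S.hlam
  obtain ⟨k, hk⟩ : ∃ k : ℕ, β - α + 1 < S.lam ^ (2*k) * (b - a) := by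
    have h1 : Tendsto (fun n => S.lam ^ n * (b - a)) atTop atTop :=
      (tendsto_pow_atTop_atTop_of_one_lt S.hlam).atTop_mul_const (by linarith)
    have h2 : Tendsto (fun n : ℕ => 2*n) atTop atTop :=
      tendsto_id.const_mul_atTop' (by norm_num)
    exact ((h1.comp h2).eventually_gt_atTop _).exists
  let w : Fin (2*k+2) → Fin (s+1) := fun j => if (j:ℕ) < 2*k then auxCode L R τ j else R
  let Z : Set (Word s) := {ω : Word s | ∀ j : Fin (2*k+2), ω (j : ℕ) = w j}
  have hZm : MeasurableSet Z := by
    have : Z = ⋂ j : Fin (2*k+2), (fun ω : Word s => ω (j:ℕ)) ⁻¹' {w j} := by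
      ext ω; simp [Z]
    rw [this]
    exact MeasurableSet.iInter fun j => measurable_pi_apply _ (measurableSet_singleton _)
  have hZpos : 0 < μ Z := by
    rw [hμ.2 (2*k+2) w, ENNReal.ofReal_pos]
    exact Finset.prod_pos fun i _ => hq _
  have hZ : ∀ ω ∈ Z, (∀ j < 2*k, ω j = auxCode L R τ j) ∧ ω (2*k) = R ∧ ω (2*k+1) = R := by
    intro ω hω
    refine ⟨fun j hj => ?_, ?_, ?_⟩
    · have := hω ⟨j, by omega⟩
      simpa [w, hj] using this
    · have := hω ⟨2*k, by omega⟩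
      simpa [w] using this
    · have := hω ⟨2*k+1, by omega⟩
      simpa [w] using this
  let A : ℝ → Set (Word s) :=
    fun x => {ω : Word s | Tendsto (fun n => itE S ω n (x:EReal)) atTop (nhds (⊤ : EReal))}
  have hA : ∀ x ω, ω ∈ A x ↔ Tendsto (fun n => itR S ω n x) atTop atTop := by
    intro x ω
    simp only [A, mem_setOf_eq, aux_itE]
    exact EReal.tendsto_coe_nhds_top_iff
  have hsub : A a ⊆ A b := by
    intro ω hω
    rw [hA] at hω ⊢
    refine tendsto_atTop_mono (fun n => ?_) hω
    have := aux_it_expand S ω n hab.le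
    have h0 : 0 ≤ S.lam ^ n * (b - a) := by
      have : 0 ≤ b - a := by linarith
      positivity
    linarith
  have hZb : Z ⊆ A b := by
    intro ω hω
    rw [hA]
    obtain ⟨h1, -, -⟩ := hZ ω hω
    have e := aux_it_congr S ω _ (2*k) h1 a
    have hge : β + 1 ≤ itR S ω (2*k) b := by
      have := aux_it_expand S ω (2*k) hab.le
      rw [e] at this
      linarith [(ha (2*k)).1]
    have hm : ∀ m, β + S.lam ^ m ≤ itR S ω (m + 2*k) b := by
      intro m
      induction m with
      | zero => simpa using hge
      | succ m ih =>
        rw [show m + 1 + 2*k = (m + 2*k) + 1 by ring]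
        simp only [itR]
        have hp : 0 < S.lam ^ m := by positivity
        have h3 := aux_expand S (ω (m+2*k)) (x := β) (y := itR S ω (m + 2*k) b) (by linarith)
        have h4 := hr (ω (m+2*k))
        have : S.lam * S.lam ^ m ≤ S.lam * (itR S ω (m + 2*k) b - β) := by
          gcongr; linarith
        rw [pow_succ]; linarith
    rw [← tendsto_add_atTop_iff_nat (2*k)]
    exact tendsto_atTop_mono hm
      (tendsto_atTop_add_const_left _ _ (tendsto_pow_atTop_atTop_of_one_lt S.hlam))
  have hZa : Disjoint (A a) Z := by
    rw [Set.disjoint_left]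
    intro ω hωa hω
    rw [hA] at hωa
    obtain ⟨h1, h2, h3⟩ := hZ ω hω
    have e := aux_it_congr S ω _ (2*k) h1 a
    have hle : ∀ m, itR S ω (m + (2*k+2)) a ≤ α := by
      intro m
      induction m with
      | zero =>
        rw [Nat.zero_add]
        simp only [itR, h2, h3, e]
        have b1 := ha (2*k+1)
        have b2 := ha (2*k+2)
        simp only [itR, auxCode_even, auxCode_odd] at b1 b2
        cases hτ : τ k
        · simp [hτ] at b1 b2
          exact hLR _ b2.2
        · simp [hτ] at b1 b2
          exact ((aux_mono S R).monotone (hLR _ b1.2)).trans (hl R)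
      | succ m ih =>
        rw [show m + 1 + (2*k+2) = (m + (2*k+2)) + 1 by ring]
        exact ((aux_mono S _).monotone ih).trans (hl _)
    obtain ⟨m, hm⟩ := (((tendsto_add_atTop_iff_nat (2*k+2)).2 hωa).eventually_gt_atTop α).exists
    exact absurd (hle m) (not_le.2 hm)
  have hle : μ (A a) + μ Z ≤ μ (A b) := by
    rw [← measure_union hZa hZm]
    exact measure_mono (union_subset hsub hZb)
  have hlt : μ (A a) < μ (A b) :=
    (ENNReal.lt_add_right (measure_ne_top _ _) hZpos.ne').trans_le hle
  exact (ENNReal.toReal_lt_toReal (measure_ne_top _ _) (measure_ne_top _ _)).2 hlt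

lemma aux_pfull_pos {p : Fin s → ℝ} (hp : ProbVec p) (i : Fin (s+1)) : 0 < pfull p i := by
  unfold pfull
  split_ifs with h
  · exact (hp.1 _).1
  · linarith [hp.2]

lemma aux_pfull_sum (p : Fin s → ℝ) : ∑ i, pfull p i = 1 := by
  rw [Fin.sum_univ_castSucc]
  simp [pfull]

end RDS

/-- **Lemma (points with different `T`-values off a countable orbit, Lemma 3.6).**
Suppose `(f_i)` satisfies the open set condition and let `x₀ ∈ J`. Then there exist
`a, b ∈ (J ∩ O) ∖ G(x₀)` with `T_p⃗(a) ≠ T_p⃗(b)`, and `b` can be chosen arbitrarily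
close to `a`: for every `ε > 0` there exist such `a, b` with `d(a,b) < ε`. -/
theorem exists_nearby_different_T_values {s : ℕ} (S : RDS s) (p : Fin s → ℝ)
    (hp : ProbVec p) (O : Set ℝ) (hO : RDS.IsOSCWitness S O)
    (x₀ : EReal) (hx₀ : x₀ ∈ RDS.Julia S) :
    ∀ ε > (0 : ℝ), ∃ a b : ℝ,
      a ∈ O ∧ b ∈ O ∧ (a : EReal) ∈ RDS.Julia S ∧ (b : EReal) ∈ RDS.Julia S ∧
      (¬ ∃ v : List (Fin (s + 1)), v ≠ [] ∧ RDS.applyWord S v x₀ = (a : EReal)) ∧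
      (¬ ∃ v : List (Fin (s + 1)), v ≠ [] ∧ RDS.applyWord S v x₀ = (b : EReal)) ∧
      RDS.Tfun S (pfull p) (a : EReal) ≠ RDS.Tfun S (pfull p) (b : EReal) ∧
      S.d (a : EReal) (b : EReal) < ε := by
  intro ε hε
  obtain ⟨⟨α, β, hab, rfl⟩, hsub, hdis⟩ := hO
  have hl := RDS.aux_left S hab hsub
  have hr := RDS.aux_right S hab hsub
  obtain ⟨L, R, hLR⟩ := RDS.aux_LR S hab hdis
  choose pt hpt using fun τ : ℕ → Bool =>
    RDS.aux_exists_pt S hab hl hr (RDS.auxCode L R τ)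
  have hinj : Function.Injective pt := by
    intro τ τ' h
    have h' := hpt τ'
    rw [← h] at h'
    exact RDS.aux_inj S hab hl hr L R hLR τ τ' _ (hpt τ) h'
  have hO : ∀ τ, pt τ ∈ Ioo α β := fun τ =>
    RDS.aux_even_mem S hab hl hr L R hLR τ _ (hpt τ) 0
  obtain ⟨C, hC, hd⟩ := S.d_equiv (Icc α β) isCompact_Icc
  let G : Set EReal := {y | ∃ v : List (Fin (s + 1)), v ≠ [] ∧ RDS.applyWord S v x₀ = y}
  have hG : G.Countable := by
    refine (countable_range fun v => RDS.applyWord S v x₀).mono ?_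
    rintro y ⟨v, -, rfl⟩
    exact ⟨v, rfl⟩
  let B : Set (ℕ → Bool) := (fun τ => ((pt τ : ℝ) : EReal)) ⁻¹' G
  have hB : B.Countable :=
    hG.preimage_of_injOn (fun x _ y _ h => hinj (EReal.coe_injective h))
  have hBc : ¬ (Bᶜ).Countable := by
    intro h
    have h2 : (univ : Set (ℕ → Bool)).Countable := by
      rw [← union_compl_self B]; exact hB.union h
    haveI : Countable (ℕ → Bool) := countable_univ_iff.1 h2
    obtain ⟨g, hg⟩ := exists_surjective_nat (ℕ → Bool)
    obtain ⟨n, hn⟩ := hg (fun n => !(g n n))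
    have := congrFun hn n
    simp at this
  let δ : ℝ := ε / C
  have hδ : 0 < δ := div_pos hε hC
  obtain ⟨τ, hτ, τ', hτ', hne, hfl⟩ : ∃ τ ∈ Bᶜ, ∃ τ' ∈ Bᶜ, τ ≠ τ' ∧
      ⌊pt τ / δ⌋ = ⌊pt τ' / δ⌋ := by
    by_contra! hc
    apply hBc
    refine MapsTo.countable_of_injOn (f := fun τ => ⌊pt τ / δ⌋) (mapsTo_univ _ _) ?_
      (countable_univ (α := ℤ))
    intro τ hτ τ' hτ' h
    by_contra hn
    exact hc τ hτ τ' hτ' hn h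
  have hclose : |pt τ - pt τ'| < δ := by
    have := Int.abs_sub_lt_one_of_floor_eq_floor hfl
    rwa [← sub_div, abs_div, abs_of_pos hδ, div_lt_one hδ] at this
  refine ⟨pt τ, pt τ', hO τ, hO τ', RDS.aux_julia S _ _ (hpt τ), RDS.aux_julia S _ _ (hpt τ'),
    hτ, hτ', ?_, ?_⟩
  · have hb := S.bern_spec (pfull p) (RDS.aux_pfull_pos hp) (RDS.aux_pfull_sum p)
    have hpos := RDS.aux_pfull_pos hp
    rcases lt_or_gt_of_ne (hinj.ne hne) with h | h
    · exact (RDS.aux_T_lt S _ hpos _ hb hl hr L R hLR τ _ _ (hpt τ) h).ne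
    · exact (RDS.aux_T_lt S _ hpos _ hb hl hr L R hLR τ' _ _ (hpt τ') h).ne'
  · refine (hd _ (Ioo_subset_Icc_self (hO τ)) _ (Ioo_subset_Icc_self (hO τ'))).2.trans_lt ?_
    calc C * |pt τ - pt τ'| < C * δ := by gcongr
      _ = ε := by simp only [δ]; field_simp
end
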